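/- arXiv:2303.11704 — 2 statements merged into one kernel-verified Lean document; each statement's English description precedes it below -/
import Mathlib

section
/- Let 1 < p < ∞, 0 < η < ∞, ω ∈ A_p^∞(φ) and f ∈ L^p(ω). Then ‖f‖_{L^p(ω)} ≤ ‖M^△_{φ,η} f‖_{L^p(ω)} ≤ C ‖M^{♯,△}_{φ,η} f‖_{L^p(ω)}, where C does not depend on f. -/
open MeasureTheory ENNReal Set Filter

noncomputable section

/-- `ℝⁿ` with the Euclidean norm. -/
abbrev En (n : ℕ) := EuclideanSpace ℝ (Fin n)

/-- The (closed) cube centered at `x` with sidelength `r`. -/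
def cube {n : ℕ} (x : En n) (r : ℝ) : Set (En n) :=
  {y | ∀ i, |y i - x i| ≤ r / 2}

/-- Weighted `L^p` norm `(∫ |f|^p w)^{1/p}` (valued in `ℝ≥0∞`). -/
def wLp {n : ℕ} (p : ℝ) (w f : En n → ℝ) : ℝ≥0∞ :=
  (∫⁻ x, ENNReal.ofReal (|f x| ^ p * w x)) ^ (1 / p)

/-- Weighted weak `L^p` norm `sup_{t>0} t · w({|f|>t})^{1/p}`. -/
def wLpWeak {n : ℕ} (p : ℝ) (w f : En n → ℝ) : ℝ≥0∞ :=
  ⨆ (t : ℝ) (_ : 0 < t), ENNReal.ofReal t *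
    (∫⁻ x in {x | t < |f x|}, ENNReal.ofReal (w x)) ^ (1 / p)

/-- The dilated kernel `K_t(x,y⃗) = t^{-mn} K(x/t, y⃗/t)`. -/
def Kt {n m : ℕ} (K : En n → (Fin m → En n) → ℝ) (t : ℝ) (x : En n)
    (y : Fin m → En n) : ℝ :=
  t ^ (-(m * n : ℝ)) * K (t⁻¹ • x) fun j => t⁻¹ • y j

/-- The multilinear square function associated with the kernel `K`. -/
def sqOp {n m : ℕ} (K : En n → (Fin m → En n) → ℝ) (f : Fin m → En n → ℝ)
    (x : En n) : ℝ :=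
  (∫ t in Ioi (0 : ℝ),
      (∫ y : Fin m → En n, Kt K t x y * ∏ j, f j (y j)) ^ 2 / t) ^ (1 / 2 : ℝ)

/-- Size condition (1.2). -/
def SizeCond (n m : ℕ) (K : En n → (Fin m → En n) → ℝ) : Prop :=
  ∀ N : ℝ, 0 ≤ N → ∃ C > 0, ∀ (y0 : En n) (y : Fin m → En n),
    0 < ∑ j, dist y0 (y j) →
    (∫ t in Ioi (0 : ℝ), (Kt K t y0 y) ^ 2 / t) ^ (1 / 2 : ℝ) ≤
      C * (∑ j, dist y0 (y j)) ^ (-(m * n : ℝ)) *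
        (1 + ∑ j, dist y0 (y j)) ^ (-N)

/-- The cube `Δ_k = Q(y₀, 2^k √(mn) |y₀ - y₀'|)`. -/
def deltaCube {n : ℕ} (m : ℕ) (y0 y0' : En n) (k : ℕ) : Set (En n) :=
  cube y0 (2 ^ k * Real.sqrt (m * n) * dist y0 y0')

/-- The "annulus" `(Δ_{k+2})^m \ (Δ_{k+1})^m`. -/
def annulus {n : ℕ} (m : ℕ) (y0 y0' : En n) (k : ℕ) : Set (Fin m → En n) :=
  {y | ∀ j, y j ∈ deltaCube m y0 y0' (k + 2)} \
    {y | ∀ j, y j ∈ deltaCube m y0 y0' (k + 1)}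

/-- Generalized smoothness condition (1.4) with constants `Ck`. -/
def GenSmoothCond (n m : ℕ) (q q' : ℝ) (Ck : ℕ → ℝ)
    (K : En n → (Fin m → En n) → ℝ) : Prop :=
  ∀ N : ℝ, 0 ≤ N → ∃ C > 0, ∀ (k : ℕ) (y0 y0' : En n), y0 ≠ y0' →
    (∫ t in Ioi (0 : ℝ),
        (∫ y in annulus m y0 y0' k, |Kt K t y0 y - Kt K t y0' y| ^ q) ^ (2 / q)
          / t) ^ (1 / 2 : ℝ) ≤
      C * Ck k * dist y0 y0' ^ (-(m * n / q')) *
        (1 + 2 ^ k * dist y0 y0') ^ (-N) * (2 : ℝ) ^ (-((k : ℝ) * m * n / q'))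

/-- Definition 1.1: a new multilinear square operator with generalized kernel. -/
structure IsGenSquareOp (n m : ℕ) (q q' : ℝ) (Ck : ℕ → ℝ)
    (K : En n → (Fin m → En n) → ℝ) : Prop where
  ck_pos : ∀ k, 0 < Ck k
  size : SizeCond n m K
  smooth : GenSmoothCond n m q q' Ck K
  weak_bound : ∃ s : Fin m → ℝ, (∀ j, 1 ≤ s j ∧ s j ≤ q') ∧ ∃ C > 0,
    ∀ f : Fin m → En n → ℝ, (∀ j, Measurable (f j)) →
      wLpWeak (∑ j, (s j)⁻¹)⁻¹ (fun _ => 1) (sqOp K f) ≤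
        ENNReal.ofReal C * ∏ j, wLp (s j) (fun _ => 1) (f j)

/-- The multiple weight `ν_{ω⃗} = ∏ ω_j^{p/p_j}`. -/
def nuW {n m : ℕ} (p : Fin m → ℝ) (w : Fin m → En n → ℝ) (x : En n) : ℝ :=
  ∏ j, w j x ^ ((∑ i, (p i)⁻¹)⁻¹ / p j)

/-- The multiple weight class `A_{p⃗}^θ(φ)`. -/
def MultiApTheta (n m : ℕ) (p : Fin m → ℝ) (θ : ℝ) (w : Fin m → En n → ℝ) : Prop :=
  (∀ j x, 0 ≤ w j x) ∧ (∀ j, LocallyIntegrable (w j) volume) ∧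
  ∃ C > 0, ∀ (x : En n) (r : ℝ), 0 < r →
    ((ENNReal.ofReal ((1 + r) ^ θ) * volume (cube x r))⁻¹ *
        ∫⁻ y in cube x r, ENNReal.ofReal (nuW p w y)) ^ (∑ i, (p i)⁻¹) *
      ∏ j,
        (if p j = 1 then
          (essInf (fun y => ENNReal.ofReal (w j y)) (volume.restrict (cube x r)))⁻¹
        else
          ((ENNReal.ofReal ((1 + r) ^ θ) * volume (cube x r))⁻¹ *
            ∫⁻ y in cube x r,
              ENNReal.ofReal (w j y) ^ (1 - p j / (p j - 1))) ^ (1 - (p j)⁻¹))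
      ≤ ENNReal.ofReal C



/-- The scalar weight class `A_p^θ(φ)` (with the `ess inf` convention at `p = 1`). -/
def ApTheta (n : ℕ) (p θ : ℝ) (w : En n → ℝ) : Prop :=
  (∀ x, 0 ≤ w x) ∧ LocallyIntegrable w volume ∧
  ∃ C > 0, ∀ (x : En n) (r : ℝ), 0 < r →
    if p = 1 then
      (ENNReal.ofReal ((1 + r) ^ θ) * volume (cube x r))⁻¹ *
          (∫⁻ y in cube x r, ENNReal.ofReal (w y)) ≤
        ENNReal.ofReal C *
          essInf (fun y => ENNReal.ofReal (w y)) (volume.restrict (cube x r))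
    else
      ((ENNReal.ofReal ((1 + r) ^ θ) * volume (cube x r))⁻¹ *
          ∫⁻ y in cube x r, ENNReal.ofReal (w y)) ^ (1 / p) *
        ((ENNReal.ofReal ((1 + r) ^ θ) * volume (cube x r))⁻¹ *
          ∫⁻ y in cube x r, ENNReal.ofReal (w y) ^ (-1 / (p - 1))) ^ (1 - 1 / p) ≤
        ENNReal.ofReal C

/-- Dyadic cube of generation `k` indexed by `v ∈ ℤⁿ`; its sidelength is `2^{-k}`. -/
def dyadicCube (n : ℕ) (k : ℤ) (v : Fin n → ℤ) : Set (En n) :=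
  {y | ∀ i, (v i : ℝ) * 2 ^ (-k) ≤ y i ∧ y i < ((v i : ℝ) + 1) * 2 ^ (-k)}

/-- Average of `f` on `Q`. -/
def cubeAvg {n : ℕ} (Q : Set (En n)) (f : En n → ℝ) : ℝ :=
  (volume Q).toReal⁻¹ * ∫ y in Q, f y

/-- The dyadic maximal function `M^△_{φ,η}`. -/
def dyadicMax (n : ℕ) (η : ℝ) (f : En n → ℝ) (x : En n) : ℝ≥0∞ :=
  ⨆ (k : ℤ) (v : Fin n → ℤ) (_ : x ∈ dyadicCube n k v),
    (ENNReal.ofReal ((1 + (2 : ℝ) ^ (-k)) ^ η) * volume (dyadicCube n k v))⁻¹ *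
      ∫⁻ y in dyadicCube n k v, ENNReal.ofReal |f y|

/-- The dyadic sharp maximal function `M^{♯,△}_{φ,η}`. -/
def sharpMax (n : ℕ) (η : ℝ) (f : En n → ℝ) (x : En n) : ℝ≥0∞ :=
  (⨆ (k : ℤ) (v : Fin n → ℤ) (_ : x ∈ dyadicCube n k v) (_ : (2 : ℝ) ^ (-k) < 1),
      (volume (dyadicCube n k v))⁻¹ *
        ∫⁻ y in dyadicCube n k v,
          ENNReal.ofReal |f y - cubeAvg (dyadicCube n k v) f|) +
  ⨆ (k : ℤ) (v : Fin n → ℤ) (_ : x ∈ dyadicCube n k v) (_ : 1 ≤ (2 : ℝ) ^ (-k)),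
    (ENNReal.ofReal ((1 + (2 : ℝ) ^ (-k)) ^ η) * volume (dyadicCube n k v))⁻¹ *
      ∫⁻ y in dyadicCube n k v, ENNReal.ofReal |f y|

def dyadicMaxDelta (n : ℕ) (δ η : ℝ) (f : En n → ℝ) (x : En n) : ℝ≥0∞ :=
  (dyadicMax n η (fun y => |f y| ^ δ) x) ^ (1 / δ)

def sharpMaxDelta (n : ℕ) (δ η : ℝ) (f : En n → ℝ) (x : En n) : ℝ≥0∞ :=
  (sharpMax n η (fun y => |f y| ^ δ) x) ^ (1 / δ)

/-- The multilinear maximal operator `𝓜_{φ,η}`. -/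
def multiMax (n m : ℕ) (η : ℝ) (f : Fin m → En n → ℝ) (x : En n) : ℝ≥0∞ :=
  ⨆ (c : En n) (r : ℝ) (_ : 0 < r) (_ : x ∈ cube c r),
    ∏ j, (ENNReal.ofReal ((1 + r) ^ η) * volume (cube c r))⁻¹ *
      ∫⁻ y in cube c r, ENNReal.ofReal |f j y|

def multiMaxDelta (n m : ℕ) (δ η : ℝ) (f : Fin m → En n → ℝ) (x : En n) : ℝ≥0∞ :=
  (multiMax n m η (fun j y => |f j y| ^ δ) x) ^ (1 / δ)

/-- `L^l` "norm" (in `z`) of an `ℝ≥0∞`-valued function, allowing `l = ∞`. -/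
def lpFull (n : ℕ) (l : ℝ≥0∞) (g : En n → ℝ≥0∞) : ℝ≥0∞ :=
  if l = ∞ then essSup g volume
  else (∫⁻ z, g z ^ l.toReal) ^ (1 / l.toReal)

/-- Weighted `L^p` norm of `f` restricted to `Q`, i.e. `‖f χ_Q‖_{L^p(w)}`. -/
def wLpOn {n : ℕ} (Q : Set (En n)) (p : ℝ) (w f : En n → ℝ) : ℝ≥0∞ :=
  (∫⁻ x in Q, ENNReal.ofReal (|f x| ^ p * w x)) ^ (1 / p)

/-- Weighted weak `L^p` norm of `f χ_Q`. -/
def wLpWeakOn {n : ℕ} (Q : Set (En n)) (p : ℝ) (w f : En n → ℝ) : ℝ≥0∞ :=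
  ⨆ (t : ℝ) (_ : 0 < t), ENNReal.ofReal t *
    (∫⁻ x in Q ∩ {x | t < |f x|}, ENNReal.ofReal (w x)) ^ (1 / p)

/-- `u(Q) = ∫_Q u`. -/
def wInt {n : ℕ} (Q : Set (En n)) (u : En n → ℝ) : ℝ≥0∞ :=
  ∫⁻ x in Q, ENNReal.ofReal (u x)

/-- The strong Morrey norm `‖f‖_{M^{p,l}_{α,λ}(u,w)}`. -/
def morreyNorm (n : ℕ) (α lam p : ℝ) (l : ℝ≥0∞) (u w f : En n → ℝ) : ℝ≥0∞ :=
  ⨆ (r : ℝ) (_ : 0 < r), lpFull n l fun z =>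
    ENNReal.ofReal ((1 + r) ^ α) * (wInt (cube z r) u) ^ (-lam) *
      wLpOn (cube z r) p w f

/-- The weak Morrey norm `‖f‖_{WM^{p,l}_{α,λ}(u,w)}`. -/
def weakMorreyNorm (n : ℕ) (α lam p : ℝ) (l : ℝ≥0∞) (u w f : En n → ℝ) : ℝ≥0∞ :=
  ⨆ (r : ℝ) (_ : 0 < r), lpFull n l fun z =>
    ENNReal.ofReal ((1 + r) ^ α) * (wInt (cube z r) u) ^ (-lam) *
      wLpWeakOn (cube z r) p w f

/-- The vector-valued Morrey norm `‖f⃗‖_{M^{p⃗,l}_{α,λ}(u,w⃗)}`. -/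
def vecMorreyNorm (n m : ℕ) (α lam : ℝ) (p : Fin m → ℝ) (l : ℝ≥0∞)
    (u : En n → ℝ) (w : Fin m → En n → ℝ) (f : Fin m → En n → ℝ) : ℝ≥0∞ :=
  ⨆ (r : ℝ) (_ : 0 < r), lpFull n l fun z =>
    ENNReal.ofReal ((1 + r) ^ α) * (wInt (cube z r) u) ^ (-lam) *
      ∏ j, wLpOn (cube z r) (p j) (w j) (f j)

/-- Weighted `L^p` norm of an `ℝ≥0∞`-valued function. -/
def wLpE (n : ℕ) (p : ℝ) (w : En n → ℝ) (g : En n → ℝ≥0∞) : ℝ≥0∞ :=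
  (∫⁻ x, g x ^ p * ENNReal.ofReal (w x)) ^ (1 / p)

/-- Weighted weak `L^p` norm of an `ℝ≥0∞`-valued function. -/
def wLpWeakE (n : ℕ) (p : ℝ) (w : En n → ℝ) (g : En n → ℝ≥0∞) : ℝ≥0∞ :=
  ⨆ (t : ℝ) (_ : 0 < t), ENNReal.ofReal t *
    (∫⁻ x in {x | ENNReal.ofReal t < g x}, ENNReal.ofReal (w x)) ^ (1 / p)


namespace FS13

/-- Dyadic cube with natural generation. -/
abbrev DQ {n : ℕ} (k : ℕ) (v : Fin n → ℤ) : Set (En n) := dyadicCube n (k : ℤ) v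

lemma mem_DQ {n : ℕ} {k : ℕ} {v : Fin n → ℤ} {y : En n} :
    y ∈ DQ k v ↔ ∀ i, ⌊y i * 2 ^ k⌋ = v i := by
  have h2 : (0 : ℝ) < 2 ^ k := by positivity
  simp only [DQ, dyadicCube, mem_ofPred_eq, Int.floor_eq_iff, zpow_neg, zpow_natCast]
  refine forall_congr' fun i => ?_
  rw [← div_eq_mul_inv, ← div_eq_mul_inv, div_le_iff₀ h2, lt_div_iff₀ h2]

lemma DQ_subset {n : ℕ} {j k : ℕ} {v w : Fin n → ℤ} {x : En n} (hjk : j ≤ k)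
    (hx : x ∈ DQ k v) (hx' : x ∈ DQ j w) : DQ k v ⊆ DQ j w := by
  intro y hy
  rw [mem_DQ] at *
  intro i
  have key : ∀ z : ℝ, ⌊z * 2 ^ j⌋ = ⌊z * 2 ^ k⌋ / ((2 ^ (k - j) : ℕ) : ℤ) := by
    intro z
    rw [← Int.floor_div_natCast]
    congr 1
    obtain ⟨d, rfl⟩ := Nat.exists_eq_add_of_le hjk
    simp only [Nat.add_sub_cancel_left, pow_add]
    push_cast
    field_simp
  rw [key, hy i, ← hx i, ← key, hx' i]

lemma exists_mem_DQ {n : ℕ} (k : ℕ) (x : En n) : ∃ v, x ∈ DQ k v :=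
  ⟨fun i => ⌊x i * 2 ^ k⌋, mem_DQ.2 fun _ => rfl⟩

lemma DQ_eq {n : ℕ} {k : ℕ} {v w : Fin n → ℤ} {x : En n}
    (hx : x ∈ DQ k v) (hx' : x ∈ DQ k w) : v = w := by
  rw [mem_DQ] at *
  funext i
  rw [← hx i, hx' i]

lemma DQ_pre {n : ℕ} (k : ℤ) (v : Fin n → ℤ) : dyadicCube n k v =
    (fun x : En n => (WithLp.ofLp x : Fin n → ℝ)) ⁻¹'
      (Set.pi univ fun i => Ico ((v i : ℝ) * 2 ^ (-k)) (((v i : ℝ) + 1) * 2 ^ (-k))) := by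
  ext y
  simp [dyadicCube]

lemma meas_DQ {n : ℕ} (k : ℤ) (v : Fin n → ℤ) : MeasurableSet (dyadicCube n k v) := by
  rw [DQ_pre]
  exact (PiLp.volume_preserving_ofLp (Fin n)).measurable
    (MeasurableSet.univ_pi fun i => measurableSet_Ico)

lemma vol_DQ {n : ℕ} (k : ℤ) (v : Fin n → ℤ) :
    volume (dyadicCube n k v) = ENNReal.ofReal (2 ^ (-k)) ^ n := by
  rw [DQ_pre]
  rw [(PiLp.volume_preserving_ofLp (Fin n)).measure_preimage
    (MeasurableSet.univ_pi fun i => measurableSet_Ico).nullMeasurableSet, Real.volume_pi_Ico]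
  simp [add_mul]

lemma vol_ne_zero {n : ℕ} (k : ℤ) (v : Fin n → ℤ) : volume (dyadicCube n k v) ≠ 0 := by
  rw [vol_DQ]
  apply pow_ne_zero
  simp only [ne_eq, ENNReal.ofReal_eq_zero, not_le]
  positivity

lemma vol_ne_top {n : ℕ} (k : ℤ) (v : Fin n → ℤ) : volume (dyadicCube n k v) ≠ ∞ := by
  rw [vol_DQ]
  exact ENNReal.pow_ne_top ENNReal.ofReal_ne_top

lemma vol_parent {n : ℕ} (k : ℕ) (v w : Fin n → ℤ) :
    volume (DQ k w) = 2 ^ n * volume (DQ (k + 1) v) := by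
  simp only [DQ]
  rw [vol_DQ, vol_DQ, ← mul_pow]
  congr 1
  rw [← ENNReal.ofReal_ofNat 2, ← ENNReal.ofReal_mul (by norm_num)]
  congr 1
  push_cast
  rw [neg_add, zpow_add₀ (by norm_num)]
  norm_num
  ring

lemma vol_cube {n : ℕ} (x : En n) (r : ℝ) :
    volume (cube x r) = ENNReal.ofReal r ^ n := by
  have : cube x r = (fun x : En n => (WithLp.ofLp x : Fin n → ℝ)) ⁻¹'
      (Icc (fun i => x i - r / 2) (fun i => x i + r / 2)) := by
    ext y
    simp only [cube, mem_ofPred_eq, mem_preimage, mem_Icc, Pi.le_def, abs_le]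
    constructor
    · intro h
      exact ⟨fun i => by linarith [(h i).1], fun i => by linarith [(h i).2]⟩
    · intro h i
      exact ⟨by linarith [h.1 i], by linarith [h.2 i]⟩
  rw [this, (PiLp.volume_preserving_ofLp (Fin n)).measure_preimage
    measurableSet_Icc.nullMeasurableSet, Real.volume_Icc_pi]
  simp

lemma DQ_subset_cube {n : ℕ} (k : ℕ) (v : Fin n → ℤ) :
    ∃ c : En n, DQ k v ⊆ cube c (2 ^ (-(k : ℤ))) := by
  refine ⟨WithLp.toLp 2 fun i => ((v i : ℝ) + 1 / 2) * 2 ^ (-(k : ℤ)), fun y hy i => ?_⟩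
  have := hy i
  simp only [abs_le]
  constructor <;> linarith [this.1, this.2]

/-- Stopping-time selection of maximal cubes. -/
lemma stopping {n : ℕ} (P : ℕ → (Fin n → ℤ) → Prop) :
    ∃ T : Set (ℕ × (Fin n → ℤ)), (∀ q ∈ T, P q.1 q.2) ∧
      (∀ q ∈ T, ∀ j w, j < q.1 → DQ q.1 q.2 ⊆ DQ j w → ¬ P j w) ∧
      T.PairwiseDisjoint (fun q => DQ q.1 q.2) ∧
      (∀ k v, P k v → DQ k v ⊆ ⋃ q ∈ T, DQ q.1 q.2) := by
  classical
  refine ⟨{q | P q.1 q.2 ∧ ∀ j w, j < q.1 → DQ q.1 q.2 ⊆ DQ j w → ¬ P j w},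
    fun q hq => hq.1, fun q hq => hq.2, ?_, ?_⟩
  · rintro ⟨k, v⟩ hq ⟨j, w⟩ hq' hne
    refine Set.disjoint_left.2 fun x hx hx' => ?_
    rcases lt_trichotomy j k with h | h | h
    · exact hq.2 j w h (DQ_subset h.le hx hx') hq'.1
    · subst h
      exact hne (Prod.ext rfl (DQ_eq hx hx'))
    · exact hq'.2 k v h (DQ_subset h.le hx' hx) hq.1
  · intro k v hP x hx
    have hex : ∃ j, ∃ w, x ∈ DQ j w ∧ P j w := ⟨k, v, hx, hP⟩
    obtain ⟨w, hxw, hPw⟩ := Nat.find_spec hex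
    simp only [mem_iUnion]
    refine ⟨(Nat.find hex, w), ⟨hPw, fun j u hj hsub hPu => ?_⟩, hxw⟩
    exact Nat.find_min hex hj ⟨u, hsub hxw, hPu⟩

/-- Average over dyadic cube. -/
def av {n : ℕ} (g : En n → ℝ≥0∞) (k : ℕ) (v : Fin n → ℤ) : ℝ≥0∞ :=
  (volume (DQ k v))⁻¹ * ∫⁻ y in DQ k v, g y

lemma lt_av {n : ℕ} {g : En n → ℝ≥0∞} {k : ℕ} {v : Fin n → ℤ} {t : ℝ≥0∞} :
    t < av g k v ↔ t * volume (DQ k v) < ∫⁻ y in DQ k v, g y := by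
  rw [av, mul_comm, ← div_eq_mul_inv, ENNReal.lt_div_iff_mul_lt (Or.inl (vol_ne_zero _ _))
    (Or.inl (vol_ne_top _ _))]

lemma vol_mul_av {n : ℕ} (g : En n → ℝ≥0∞) (k : ℕ) (v : Fin n → ℤ) :
    volume (DQ k v) * av g k v = ∫⁻ y in DQ k v, g y := by
  rw [av, ← mul_assoc, ENNReal.mul_inv_cancel (vol_ne_zero _ _) (vol_ne_top _ _), one_mul]

/-- local dyadic maximal function -/
def DM {n : ℕ} (g : En n → ℝ≥0∞) (x : En n) : ℝ≥0∞ :=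
  ⨆ (k : ℕ) (v : Fin n → ℤ) (_ : x ∈ DQ k v), av g k v

lemma lt_DM {n : ℕ} {g : En n → ℝ≥0∞} {x : En n} {t : ℝ≥0∞} :
    t < DM g x ↔ ∃ k v, x ∈ DQ k v ∧ t < av g k v := by
  simp [DM, lt_iSup_iff]

lemma meas_iSup_mem {n : ℕ} (Q : Set (En n)) (hQ : MeasurableSet Q) (c : ℝ≥0∞) :
    Measurable fun x => ⨆ (_ : x ∈ Q), c := by
  classical
  have : (fun x => ⨆ (_ : x ∈ Q), c) = Q.indicator fun _ => c := by
    ext x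
    by_cases h : x ∈ Q <;> simp [h]
  rw [this]
  exact measurable_const.indicator hQ

lemma meas_DM {n : ℕ} (g : En n → ℝ≥0∞) : Measurable (DM g) :=
  Measurable.iSup fun _ => Measurable.iSup fun _ => meas_iSup_mem _ (meas_DQ _ _) _

lemma meas_dyadicMax {n : ℕ} (η : ℝ) (f : En n → ℝ) : Measurable (dyadicMax n η f) :=
  Measurable.iSup fun _ => Measurable.iSup fun _ => meas_iSup_mem _ (meas_DQ _ _) _

lemma meas_sharpMax {n : ℕ} (η : ℝ) (f : En n → ℝ) : Measurable (sharpMax n η f) :=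
  (Measurable.iSup fun _ => Measurable.iSup fun _ => meas_iSup_mem _ (meas_DQ _ _) _).add
  (Measurable.iSup fun _ => Measurable.iSup fun _ => meas_iSup_mem _ (meas_DQ _ _) _)

/-- Weak type bound. -/
lemma weak_type {n : ℕ} (g : En n → ℝ≥0∞) (k : ℕ) (v : Fin n → ℤ) (t : ℝ≥0∞) (E : Set (En n))
    (hE : ∀ x ∈ E, ∃ j w, x ∈ DQ j w ∧ DQ j w ⊆ DQ k v ∧ t < av g j w) :
    t * volume E ≤ ∫⁻ y in DQ k v, g y := by
  obtain ⟨T, hT1, -, hT3, hT4⟩ := stopping (fun j w => DQ j w ⊆ DQ k v ∧ t < av g j w)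
  have hc : T.Countable := T.to_countable
  calc t * volume E ≤ t * volume (⋃ q ∈ T, DQ q.1 q.2) := by
        gcongr
        intro x hx
        obtain ⟨j, w, h1, h2⟩ := hE x hx
        exact hT4 j w h2 h1
    _ = ∑' q : T, t * volume (DQ q.1.1 q.1.2) := by
        rw [measure_biUnion hc hT3 fun q _ => meas_DQ _ _, ENNReal.tsum_mul_left]
    _ ≤ ∑' q : T, ∫⁻ y in DQ q.1.1 q.1.2, g y := by
        refine ENNReal.tsum_le_tsum fun q => (lt_av.1 (hT1 q q.2).2).le
    _ = ∫⁻ y in ⋃ q ∈ T, DQ q.1 q.2, g y :=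
        (lintegral_biUnion hc (fun q _ => meas_DQ _ _) hT3 _).symm
    _ ≤ _ := lintegral_mono_set (iUnion₂_subset fun q hq => (hT1 q hq).1)

/-- absolute value as extended nonneg function -/
abbrev ab {n : ℕ} (f : En n → ℝ) (y : En n) : ℝ≥0∞ := ENNReal.ofReal |f y|

lemma av_le_add {n : ℕ} {g h : En n → ℝ≥0∞} {c : ℝ≥0∞} (H : ∀ y, g y ≤ h y + c)
    (k : ℕ) (v : Fin n → ℤ) : av g k v ≤ av h k v + c := by
  calc av g k v ≤ (volume (DQ k v))⁻¹ * ∫⁻ y in DQ k v, (h y + c) := by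
        unfold av; gcongr; exact H _
    _ = av h k v + c := by
        rw [lintegral_add_right _ measurable_const, mul_add, lintegral_const, av]
        congr 1
        rw [Measure.restrict_apply_univ, mul_comm c, ← mul_assoc,
          ENNReal.inv_mul_cancel (vol_ne_zero _ _) (vol_ne_top _ _), one_mul]

lemma cubeAvg_le {n : ℕ} (f : En n → ℝ) (k : ℕ) (v : Fin n → ℤ) :
    ENNReal.ofReal |cubeAvg (DQ k v) f| ≤ av (ab f) k v := by
  unfold cubeAvg av
  rw [abs_mul, ENNReal.ofReal_mul (abs_nonneg _), abs_of_nonneg (by positivity),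
    ENNReal.ofReal_inv_of_pos (ENNReal.toReal_pos (vol_ne_zero _ _) (vol_ne_top _ _)),
    ENNReal.ofReal_toReal (vol_ne_top _ _)]
  gcongr
  have := enorm_integral_le_lintegral_enorm (μ := volume.restrict (DQ k v)) f
  simpa only [Real.enorm_eq_ofReal_abs] using this

lemma F2 {n : ℕ} {η : ℝ} (f : En n → ℝ) {v : Fin n → ℤ} {x : En n} (hx : x ∈ DQ 0 v) :
    av (ab f) 0 v ≤ ENNReal.ofReal (2 ^ η) * sharpMax n η f x := by
  have hpos : (0 : ℝ) < 2 ^ η := by positivity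
  have h0 : ENNReal.ofReal (2 ^ η) ≠ 0 := by simpa using hpos
  have h1 : (ENNReal.ofReal ((1 + (2 : ℝ) ^ (-((0 : ℕ) : ℤ))) ^ η) * volume (DQ 0 v))⁻¹ *
      ∫⁻ y in DQ 0 v, ENNReal.ofReal |f y| ≤ sharpMax n η f x := by
    refine le_trans ?_ le_add_self
    refine le_iSup_of_le ((0 : ℕ) : ℤ) (le_iSup_of_le v (le_iSup_of_le hx
      (le_iSup_of_le (by simp) le_rfl)))
  have h2 : (1 : ℝ) + (2 : ℝ) ^ (-((0 : ℕ) : ℤ)) = 2 := by norm_num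
  rw [h2, ENNReal.mul_inv (Or.inl h0) (Or.inl ENNReal.ofReal_ne_top), mul_assoc] at h1
  change (ENNReal.ofReal (2 ^ η))⁻¹ * av (ab f) 0 v ≤ _ at h1
  calc av (ab f) 0 v = ENNReal.ofReal (2 ^ η) * ((ENNReal.ofReal (2 ^ η))⁻¹ * av (ab f) 0 v) := by
        rw [← mul_assoc, ENNReal.mul_inv_cancel h0 ENNReal.ofReal_ne_top, one_mul]
    _ ≤ _ := by gcongr

lemma F3 {n : ℕ} {η : ℝ} (hη : 0 < η) (f : En n → ℝ) {k : ℕ} {v : Fin n → ℤ} {x : En n}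
    (hx : x ∈ DQ k v) :
    av (fun y => ENNReal.ofReal |f y - cubeAvg (DQ k v) f|) k v ≤
      2 * ENNReal.ofReal (2 ^ η) * sharpMax n η f x := by
  rcases Nat.eq_zero_or_pos k with rfl | hk
  · calc _ ≤ av (ab f) 0 v + ENNReal.ofReal |cubeAvg (DQ 0 v) f| := by
          refine av_le_add (fun y => ?_) _ _
          rw [← ENNReal.ofReal_add (abs_nonneg _) (abs_nonneg _)]
          exact ENNReal.ofReal_le_ofReal (abs_sub _ _)
      _ ≤ av (ab f) 0 v + av (ab f) 0 v := by gcongr; exact cubeAvg_le _ _ _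
      _ ≤ ENNReal.ofReal (2 ^ η) * sharpMax n η f x +
          ENNReal.ofReal (2 ^ η) * sharpMax n η f x := add_le_add (F2 f hx) (F2 f hx)
      _ = _ := by rw [← two_mul, mul_assoc]
  · have h1 : av (fun y => ENNReal.ofReal |f y - cubeAvg (DQ k v) f|) k v ≤ sharpMax n η f x := by
      refine le_trans ?_ le_self_add
      refine le_iSup_of_le (k : ℤ) (le_iSup_of_le v (le_iSup_of_le hx
        (le_iSup_of_le ?_ le_rfl)))
      rw [zpow_neg, zpow_natCast]
      exact inv_lt_one_of_one_lt₀ (one_lt_pow₀ (by norm_num) hk.ne')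
    refine h1.trans (le_mul_of_one_le_left (zero_le) ?_)
    have : (1 : ℝ≥0∞) ≤ ENNReal.ofReal (2 ^ η) := by
      rw [← ENNReal.ofReal_one]
      exact ENNReal.ofReal_le_ofReal (Real.one_le_rpow (by norm_num) hη.le)
    calc (1 : ℝ≥0∞) ≤ 2 * 1 := by norm_num
      _ ≤ _ := by gcongr

lemma F1 {n : ℕ} {η : ℝ} (hη : 0 < η) (f : En n → ℝ) (x : En n) :
    dyadicMax n η f x ≤ max (sharpMax n η f x) (DM (ab f) x) := by
  refine iSup_le fun k => iSup_le fun v => iSup_le fun hx => ?_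
  by_cases hk : 1 ≤ (2 : ℝ) ^ (-k)
  · refine le_trans ?_ (le_max_left _ _)
    refine le_trans ?_ le_add_self
    exact le_iSup_of_le k (le_iSup_of_le v (le_iSup_of_le hx (le_iSup_of_le hk le_rfl)))
  · refine le_trans ?_ (le_max_right _ _)
    have hk0 : 0 ≤ k := by
      by_contra h
      exact hk (one_le_zpow₀ (by norm_num) (by omega))
    obtain ⟨m, rfl⟩ := Int.eq_ofNat_of_zero_le hk0
    refine le_trans ?_ (le_iSup_of_le m (le_iSup_of_le v (le_iSup_of_le hx le_rfl)))
    unfold av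
    gcongr
    refine le_mul_of_one_le_left zero_le ?_
    rw [← ENNReal.ofReal_one]
    refine ENNReal.ofReal_le_ofReal (Real.one_le_rpow ?_ hη.le)
    have : (0 : ℝ) < 2 ^ (-(m : ℤ)) := by positivity
    linarith

/-- the A-infinity type property -/
def AInf {n : ℕ} (μ : Measure (En n)) (δ : ℝ≥0∞) : Prop :=
  ∀ (k : ℕ) (v : Fin n → ℤ) (E : Set (En n)), MeasurableSet E → E ⊆ DQ k v →
    2 * volume E ≤ volume (DQ k v) → μ E ≤ δ * μ (DQ k v)

lemma goodlam {n : ℕ} {η : ℝ} (hη : 0 < η) (f : En n → ℝ) (μ : Measure (En n)) (δ : ℝ≥0∞)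
    (hμ : AInf μ δ) (v0 : Fin n → ℤ) (l b γ : ℝ≥0∞) (hl0 : l ≠ 0) (hl : l ≠ ∞)
    (hb0 : b ≠ 0) (hb : b ≠ ∞)
    (hγ : 2 * (2 ^ n * (2 * ENNReal.ofReal (2 ^ η) * γ)) ≤ b)
    (hav : av (ab f) 0 v0 ≤ l) :
    μ (DQ 0 v0 ∩ {x | l + b * l < DM (ab f) x}) ≤
      δ * μ (DQ 0 v0 ∩ {x | l < DM (ab f) x}) +
      μ (DQ 0 v0 ∩ {x | γ * l < sharpMax n η f x}) := by
  obtain ⟨T, hT1, hT2, hT3, hT4⟩ := stopping (fun k v => DQ k v ⊆ DQ 0 v0 ∧ l < av (ab f) k v)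
  have hc : T.Countable := T.to_countable
  set U := ⋃ q ∈ T, DQ q.1 q.2 with hU
  set G := {x | l + b * l < DM (ab f) x} ∩ {x | sharpMax n η f x ≤ γ * l} with hG
  have hGm : MeasurableSet G :=
    (measurableSet_lt measurable_const (meas_DM _)).inter
      (measurableSet_le (meas_sharpMax _ _) measurable_const)
  have hUs : U ⊆ DQ 0 v0 ∩ {x | l < DM (ab f) x} := by
    refine iUnion₂_subset fun q hq x hx => ⟨(hT1 q hq).1 hx, lt_DM.2 ⟨q.1, q.2, hx, (hT1 q hq).2⟩⟩
  have hsU : DQ 0 v0 ∩ {x | l < DM (ab f) x} ⊆ U := by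
    rintro x ⟨hx0, hx⟩
    obtain ⟨k, v, hxk, hlt⟩ := lt_DM.1 hx
    exact hT4 k v ⟨DQ_subset (Nat.zero_le _) hxk hx0, hlt⟩ hxk
  have key : ∀ q ∈ T, 2 * volume (DQ q.1 q.2 ∩ G) ≤ volume (DQ q.1 q.2) := by
    rintro ⟨k, v⟩ hq
    dsimp only
    rcases (DQ k v ∩ G).eq_empty_or_nonempty with h | ⟨x0, hx0, hxG⟩
    · simp [h]
    have hP := hT1 _ hq
    have hmin := hT2 _ hq
    dsimp only at hP hmin
    have hk : k ≠ 0 := by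
      rintro rfl
      rw [DQ_eq hx0 (hP.1 hx0)] at hP
      exact absurd hP.2 (not_lt.2 hav)
    obtain ⟨k, rfl⟩ := Nat.exists_eq_succ_of_ne_zero hk
    rw [Nat.succ_eq_add_one] at *
    obtain ⟨w, hw⟩ := exists_mem_DQ k x0
    have hsub : DQ (k + 1) v ⊆ DQ k w := DQ_subset (Nat.le_succ k) hx0 hw
    have hbig : ∀ j u x, j < k + 1 → x ∈ DQ (k + 1) v → x ∈ DQ j u → av (ab f) j u ≤ l := by
      intro j u x hj hx hxu
      by_contra hcon
      exact hmin j u hj (DQ_subset hj.le hx hxu)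
        ⟨DQ_subset (Nat.zero_le _) hxu (hP.1 hx), not_le.1 hcon⟩
    set c := cubeAvg (DQ k w) f with hcdef
    have hcl : ENNReal.ofReal |c| ≤ l :=
      (cubeAvg_le f k w).trans (hbig k w x0 (Nat.lt_succ_self k) hx0 hw)
    have hweak := weak_type (fun y => ENNReal.ofReal |f y - c|) (k + 1) v (b * l)
      (DQ (k + 1) v ∩ G) (by
        rintro x ⟨hx, hxG'⟩
        obtain ⟨j, u, hxu, hlt⟩ := lt_DM.1 hxG'.1
        have hj : k + 1 ≤ j := by
          by_contra hcon
          refine absurd hlt (not_lt.2 ((hbig j u x (by omega) hx hxu).trans le_self_add))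
        refine ⟨j, u, hxu, DQ_subset hj hxu hx, ?_⟩
        have h1 : av (ab f) j u ≤ av (fun y => ENNReal.ofReal |f y - c|) j u + l := by
          refine (av_le_add (c := ENNReal.ofReal |c|) (fun y => ?_) _ _).trans
            (add_le_add le_rfl hcl)
          rw [← ENNReal.ofReal_add (abs_nonneg _) (abs_nonneg _)]
          refine ENNReal.ofReal_le_ofReal ?_
          have := abs_add_le (f y - c) c
          simpa using this
        have h2 := hlt.trans_le h1
        rw [add_comm] at h2
        exact (ENNReal.add_lt_add_iff_right hl).1 h2)
    have h3 : b * l * volume (DQ (k + 1) v ∩ G) * 2 ≤ b * l * volume (DQ (k + 1) v) := by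
      calc _ ≤ (∫⁻ y in DQ (k + 1) v, ENNReal.ofReal |f y - c|) * 2 := by gcongr
        _ ≤ (∫⁻ y in DQ k w, ENNReal.ofReal |f y - c|) * 2 := by
            gcongr
        _ = volume (DQ k w) * av (fun y => ENNReal.ofReal |f y - c|) k w * 2 := by
            rw [vol_mul_av]
        _ ≤ (2 ^ n * volume (DQ (k + 1) v)) *
            (2 * ENNReal.ofReal (2 ^ η) * (γ * l)) * 2 := by
            rw [vol_parent k v w]
            gcongr
            exact (F3 hη f hw).trans (by gcongr; exact hxG.2)
        _ = (2 * (2 ^ n * (2 * ENNReal.ofReal (2 ^ η) * γ))) * (l * volume (DQ (k + 1) v)) := by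
            ring
        _ ≤ b * (l * volume (DQ (k + 1) v)) := by gcongr
        _ = _ := by ring
    rw [mul_assoc, mul_comm _ (2 : ℝ≥0∞)] at h3
    exact (ENNReal.mul_le_mul_iff_right (mul_ne_zero hb0 hl0) (ENNReal.mul_ne_top hb hl)).1 h3
  have hUG : μ (U ∩ G) ≤ δ * μ U := by
    rw [hU, iUnion₂_inter, measure_biUnion hc (hT3.mono fun q => inter_subset_left)
      (fun q _ => (meas_DQ _ _).inter hGm), measure_biUnion hc hT3 (fun q _ => meas_DQ _ _),
      ← ENNReal.tsum_mul_left]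
    refine ENNReal.tsum_le_tsum fun q => ?_
    exact hμ _ _ _ ((meas_DQ _ _).inter hGm) inter_subset_left (key _ q.2)
  calc _ ≤ μ ((U ∩ G) ∪ (DQ 0 v0 ∩ {x | γ * l < sharpMax n η f x})) := by
        refine measure_mono ?_
        rintro x ⟨hx, hxl⟩
        by_cases hs : sharpMax n η f x ≤ γ * l
        · exact Or.inl ⟨hsU ⟨hx, show l < DM (ab f) x from lt_of_le_of_lt le_self_add hxl⟩, hxl, hs⟩
        · exact Or.inr ⟨hx, not_le.1 hs⟩
    _ ≤ _ := (measure_union_le _ _).trans (add_le_add (hUG.trans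
        (mul_le_mul' le_rfl (measure_mono hUs))) le_rfl)

lemma geom_bound (A e : ℝ≥0∞) (hA : A = 1 + e) (he0 : e ≠ 0) (he : e ≠ ∞) (J : ℕ) :
    ∑ j ∈ Finset.range (J + 1), A ^ j ≤ (1 + e⁻¹) * A ^ J := by
  induction J with
  | zero => simp
  | succ J ih =>
    rw [Finset.sum_range_succ]
    calc _ ≤ (1 + e⁻¹) * A ^ J + A ^ (J + 1) := by gcongr
      _ = ((1 + e⁻¹) + A) * A ^ J := by ring
      _ = ((1 + e⁻¹) * A) * A ^ J := by
          congr 1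
          rw [hA, mul_add, mul_one, add_mul, one_mul, ENNReal.inv_mul_cancel he0 he, add_comm e 1]
      _ = _ := by ring

/-- level-set upper bound -/
lemma level_upper (p : ℝ) (hp : 0 < p) (a l g : ℝ≥0∞) (ha : 1 ≤ a) (hl0 : l ≠ 0) (hl : l ≠ ∞) :
    g ^ p ≤ l ^ p + ∑' j : ℕ, (a ^ p) ^ (j + 1) * l ^ p *
      ({x : ℝ≥0∞ | a ^ j * l < x}.indicator 1 g) := by
  classical
  have hlp : l ^ p ≠ 0 := by simp [ENNReal.rpow_eq_zero_iff, hl0, hl]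
  have hAp : 1 ≤ a ^ p := by
    simpa using ENNReal.rpow_le_rpow ha hp.le
  by_cases h : ∃ J : ℕ, g ≤ a ^ J * l
  · rcases Nat.eq_zero_or_pos (Nat.find h) with h0 | h0
    · have := Nat.find_spec h
      rw [h0, pow_zero, one_mul] at this
      exact (ENNReal.rpow_le_rpow this hp.le).trans le_self_add
    · obtain ⟨j, hj⟩ := Nat.exists_eq_succ_of_ne_zero h0.ne'
      have h1 := Nat.find_spec h
      have h2 := Nat.find_min h (m := j) (by omega)
      rw [hj] at h1
      refine le_trans ?_ le_add_self
      refine le_trans ?_ (ENNReal.le_tsum j)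
      rw [indicator_of_mem (show g ∈ {x : ℝ≥0∞ | a ^ j * l < x} from not_le.1 h2)]
      rw [Pi.one_apply, mul_one]
      refine (ENNReal.rpow_le_rpow h1 hp.le).trans (le_of_eq ?_)
      rw [ENNReal.mul_rpow_of_nonneg _ _ hp.le, ← ENNReal.rpow_natCast, ← ENNReal.rpow_natCast,
        ← ENNReal.rpow_mul, ← ENNReal.rpow_mul, mul_comm p]
  · push Not at h
    refine le_trans le_top ?_
    refine le_trans ?_ le_add_self
    rw [← ENNReal.tsum_const_eq_top_of_ne_zero (α := ℕ) hlp]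
    refine ENNReal.tsum_le_tsum fun j => ?_
    rw [indicator_of_mem (show g ∈ {x : ℝ≥0∞ | a ^ j * l < x} from h j), Pi.one_apply, mul_one]
    exact le_mul_of_one_le_left zero_le (one_le_pow₀ hAp)

lemma level_lower (p : ℝ) (hp : 0 < p) (a l g e : ℝ≥0∞) (hA : a ^ p = 1 + e) (he0 : e ≠ 0)
    (he : e ≠ ∞) :
    ∑' j : ℕ, (a ^ p) ^ j * l ^ p * ({x : ℝ≥0∞ | a ^ j * l < x}.indicator 1 g) ≤
      (1 + e⁻¹) * g ^ p := by
  classical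
  refine ENNReal.tsum_le_of_sum_range_le fun J => ?_
  induction J with
  | zero => simp
  | succ J ih =>
    by_cases h : a ^ J * l < g
    · calc _ ≤ ∑ j ∈ Finset.range (J + 1), (a ^ p) ^ j * l ^ p := by
            refine Finset.sum_le_sum fun j _ => ?_
            refine mul_le_of_le_one_right zero_le ?_
            exact indicator_le_self' (f := (1 : ℝ≥0∞ → ℝ≥0∞)) (fun _ _ => zero_le) g
        _ = (∑ j ∈ Finset.range (J + 1), (a ^ p) ^ j) * l ^ p := by rw [Finset.sum_mul]
        _ ≤ (1 + e⁻¹) * (a ^ p) ^ J * l ^ p := by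
            gcongr
            exact geom_bound _ e hA he0 he J
        _ = (1 + e⁻¹) * (a ^ J * l) ^ p := by
            rw [ENNReal.mul_rpow_of_nonneg _ _ hp.le, ← ENNReal.rpow_natCast,
              ← ENNReal.rpow_natCast, ← ENNReal.rpow_mul, ← ENNReal.rpow_mul, mul_comm p, mul_assoc]
        _ ≤ _ := by gcongr
    · rw [Finset.sum_range_succ, indicator_of_notMem (by simpa using h), mul_zero, add_zero]
      exact ih

lemma iter_bound (m s : ℕ → ℝ≥0∞) (A δ K : ℝ≥0∞) (hK : 1 + A * δ * K ≤ K)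
    (h : ∀ j, m (j + 1) ≤ δ * m j + s j) :
    ∑' j, A ^ j * m j ≤ K * (m 0 + A * ∑' j, A ^ j * s j) := by
  refine ENNReal.tsum_le_of_sum_range_le fun J => ?_
  induction J with
  | zero => simp
  | succ J ih =>
    rw [Finset.sum_range_succ']
    set B := m 0 + A * ∑' j, A ^ j * s j with hB
    calc _ ≤ ∑ j ∈ Finset.range J, (A * δ * (A ^ j * m j) + A * (A ^ j * s j)) + A ^ 0 * m 0 := by
          gcongr with j _
          calc A ^ (j + 1) * m (j + 1) ≤ A ^ (j + 1) * (δ * m j + s j) := by gcongr; exact h j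
            _ = _ := by ring
      _ = A * δ * (∑ j ∈ Finset.range J, A ^ j * m j) +
          (m 0 + A * ∑ j ∈ Finset.range J, A ^ j * s j) := by
          rw [Finset.sum_add_distrib, Finset.mul_sum, Finset.mul_sum]; ring
      _ ≤ A * δ * (K * B) + B := by
          gcongr
          rw [hB]
          gcongr
          exact ENNReal.sum_le_tsum _
      _ = (1 + A * δ * K) * B := by ring
      _ ≤ K * B := by gcongr

lemma local_bound {n : ℕ} {η : ℝ} (hη : 0 < η) (p : ℝ) (hp : 0 < p) (f : En n → ℝ)
    (μ : Measure (En n)) (δ : ℝ≥0∞)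
    (hμ : AInf μ δ) (v0 : Fin n → ℤ) (b γ e K : ℝ≥0∞)
    (hb0 : b ≠ 0) (hb : b ≠ ∞) (hγ0 : γ ≠ 0) (hγt : γ ≠ ∞)
    (hγ : 2 * (2 ^ n * (2 * ENNReal.ofReal (2 ^ η) * γ)) ≤ b)
    (hA : (1 + b) ^ p = 1 + e) (he0 : e ≠ 0) (he : e ≠ ∞)
    (hK : 1 + (1 + b) ^ p * δ * K ≤ K) :
    ∫⁻ x in DQ 0 v0, DM (ab f) x ^ p ∂μ ≤
      (1 + (ENNReal.ofReal (2 ^ η) ^ p + (1 + b) ^ p * K * (ENNReal.ofReal (2 ^ η) ^ p +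
        (1 + b) ^ p * (((1 + e⁻¹)) * (γ ^ p)⁻¹)))) *
      ∫⁻ x in DQ 0 v0, sharpMax n η f x ^ p ∂μ := by
  set l := av (ab f) 0 v0 with hl_def
  set X := ∫⁻ x in DQ 0 v0, sharpMax n η f x ^ p ∂μ with hX
  have hQm : MeasurableSet (DQ 0 v0) := meas_DQ _ _
  by_cases hl0 : l = 0
  · have h0 : ∀ x ∈ DQ 0 v0, DM (ab f) x ^ p = 0 := by
      intro x hx
      have : DM (ab f) x = 0 := by
        by_contra hne
        obtain ⟨k, v, hxk, hlt⟩ := lt_DM.1 (pos_iff_ne_zero.2 hne)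
        have hz := vol_mul_av (ab f) 0 v0
        rw [← hl_def, hl0, mul_zero] at hz
        have hz' : ∫⁻ y in DQ k v, ab f y ≤ 0 := by
          rw [hz]
          exact lintegral_mono_set (DQ_subset (Nat.zero_le _) hxk hx)
        rw [lt_av, zero_mul] at hlt
        exact absurd hlt (not_lt.2 hz')
      rw [this, ENNReal.zero_rpow_of_pos hp]
    rw [setLIntegral_congr_fun hQm h0]
    simp
  by_cases hl : l = ∞
  · have h1 : ∫⁻ x in DQ 0 v0, DM (ab f) x ^ p ∂μ ≤ X := by
      refine setLIntegral_mono' hQm fun x hx => ?_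
      have := F2 (η := η) f hx
      rw [← hl_def, hl, top_le_iff] at this
      have hS : sharpMax n η f x = ∞ := by
        by_contra hne
        exact ENNReal.mul_ne_top ENNReal.ofReal_ne_top hne this
      rw [hS, ENNReal.top_rpow_of_pos hp]
      exact le_top
    refine h1.trans (le_mul_of_one_le_left zero_le le_self_add)
  set a := 1 + b with ha
  have ha1 : 1 ≤ a := le_self_add
  set A := a ^ p with hAdef
  have hA0 : ∀ j : ℕ, a ^ j * l ≠ 0 := fun j =>
    mul_ne_zero (pow_ne_zero _ (by simp [ha])) hl0
  have hAt : ∀ j : ℕ, a ^ j * l ≠ ∞ := fun j =>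
    ENNReal.mul_ne_top (ENNReal.pow_ne_top (by simp [ha, hb])) hl
  set m : ℕ → ℝ≥0∞ := fun j => μ (DQ 0 v0 ∩ {x | a ^ j * l < DM (ab f) x}) with hm
  set s : ℕ → ℝ≥0∞ := fun j => μ (DQ 0 v0 ∩ {x | γ * (a ^ j * l) < sharpMax n η f x}) with hs
  have hrec : ∀ j, m (j + 1) ≤ δ * m j + s j := by
    intro j
    have := goodlam hη f μ δ hμ v0 (a ^ j * l) b γ (hA0 j) (hAt j) hb0 hb hγ
      (le_mul_of_one_le_left zero_le (one_le_pow₀ ha1))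
    have h2 : a ^ (j + 1) * l = a ^ j * l + b * (a ^ j * l) := by
      rw [pow_succ, ha]; ring
    simp only [hm, h2]
    exact this
  have hiter := iter_bound m s A δ K hK hrec
  have hind : ∀ (c : ℝ≥0∞) (g : En n → ℝ≥0∞), Measurable g →
      ∫⁻ x in DQ 0 v0, ({y : ℝ≥0∞ | c < y}.indicator 1 (g x)) ∂μ = μ (DQ 0 v0 ∩ {x | c < g x}) := by
    intro c g hg
    have hms : MeasurableSet {x | c < g x} := measurableSet_lt measurable_const hg
    have : (fun x => ({y : ℝ≥0∞ | c < y}.indicator (1 : ℝ≥0∞ → ℝ≥0∞) (g x))) =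
        {x | c < g x}.indicator 1 := by
      ext x
      simp only [indicator]
      rfl
    rw [this, lintegral_indicator_one hms, Measure.restrict_apply hms, inter_comm]
  have hindm : ∀ (c : ℝ≥0∞) (g : En n → ℝ≥0∞), Measurable g →
      Measurable fun x => ({y : ℝ≥0∞ | c < y}.indicator (1 : ℝ≥0∞ → ℝ≥0∞) (g x)) := by
    intro c g hg
    exact (measurable_one.indicator (measurableSet_lt measurable_const measurable_id)).comp hg
  have hDM := meas_DM (ab f)
  have hSm := meas_sharpMax (n := n) η f
  have hup : ∫⁻ x in DQ 0 v0, DM (ab f) x ^ p ∂μ ≤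
      l ^ p * μ (DQ 0 v0) + A * l ^ p * ∑' j, A ^ j * m j := by
    calc _ ≤ ∫⁻ x in DQ 0 v0, (l ^ p + ∑' j : ℕ, A ^ (j + 1) * l ^ p *
          ({y : ℝ≥0∞ | a ^ j * l < y}.indicator 1 (DM (ab f) x))) ∂μ :=
          lintegral_mono fun x => level_upper p hp a l _ ha1 hl0 hl
      _ = l ^ p * μ (DQ 0 v0) + ∑' j : ℕ, A ^ (j + 1) * l ^ p * m j := by
          rw [lintegral_add_left measurable_const, lintegral_const, Measure.restrict_apply_univ,
            lintegral_tsum fun j => ((hindm _ _ hDM).const_mul _).aemeasurable]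
          congr 1
          refine tsum_congr fun j => ?_
          rw [lintegral_const_mul _ (hindm _ _ hDM), hind _ _ hDM]
      _ = _ := by
          rw [← ENNReal.tsum_mul_left]
          congr 1
          refine tsum_congr fun j => ?_
          ring
  have hD : l ^ p * μ (DQ 0 v0) ≤ ENNReal.ofReal (2 ^ η) ^ p * X := by
    calc l ^ p * μ (DQ 0 v0) = ∫⁻ x in DQ 0 v0, l ^ p ∂μ := by
          rw [lintegral_const, Measure.restrict_apply_univ]
      _ ≤ ∫⁻ x in DQ 0 v0, ENNReal.ofReal (2 ^ η) ^ p * sharpMax n η f x ^ p ∂μ := by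
          refine setLIntegral_mono' hQm fun x hx => ?_
          rw [← ENNReal.mul_rpow_of_nonneg _ _ hp.le]
          exact ENNReal.rpow_le_rpow (F2 f hx) hp.le
      _ = _ := by rw [lintegral_const_mul _ (hSm.pow_const p)]
  have hγp0 : γ ^ p ≠ 0 := by simp [ENNReal.rpow_eq_zero_iff, hγ0, hγt]
  have hγpt : γ ^ p ≠ ∞ := ENNReal.rpow_ne_top_of_nonneg hp.le hγt
  have hF : l ^ p * ∑' j, A ^ j * s j ≤ ((1 + e⁻¹) * (γ ^ p)⁻¹) * X := by
    have h1 : γ ^ p * (l ^ p * ∑' j, A ^ j * s j) ≤ (1 + e⁻¹) * X := by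
      calc _ = ∑' j, A ^ j * (γ * l) ^ p * s j := by
            rw [← mul_assoc, ← ENNReal.mul_rpow_of_nonneg _ _ hp.le, ← ENNReal.tsum_mul_left]
            refine tsum_congr fun j => ?_
            ring
        _ = ∫⁻ x in DQ 0 v0, ∑' j : ℕ, A ^ j * (γ * l) ^ p *
          ({y : ℝ≥0∞ | a ^ j * (γ * l) < y}.indicator 1 (sharpMax n η f x)) ∂μ := by
            rw [lintegral_tsum fun j => ((hindm _ _ hSm).const_mul _).aemeasurable]
            refine tsum_congr fun j => ?_
            rw [lintegral_const_mul _ (hindm _ _ hSm), hind _ _ hSm, mul_left_comm (a ^ j) γ l]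
        _ ≤ ∫⁻ x in DQ 0 v0, (1 + e⁻¹) * sharpMax n η f x ^ p ∂μ :=
            lintegral_mono fun x => level_lower p hp a _ _ e hA he0 he
        _ = _ := by rw [lintegral_const_mul _ (hSm.pow_const p)]
    calc _ = (γ ^ p)⁻¹ * (γ ^ p * (l ^ p * ∑' j, A ^ j * s j)) := by
          rw [← mul_assoc, ENNReal.inv_mul_cancel hγp0 hγpt, one_mul]
      _ ≤ (γ ^ p)⁻¹ * ((1 + e⁻¹) * X) := by gcongr
      _ = _ := by ring
  have hm0 : m 0 ≤ μ (DQ 0 v0) := measure_mono inter_subset_left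
  calc _ ≤ l ^ p * μ (DQ 0 v0) + A * l ^ p * ∑' j, A ^ j * m j := hup
    _ ≤ l ^ p * μ (DQ 0 v0) + A * l ^ p * (K * (μ (DQ 0 v0) + A * ∑' j, A ^ j * s j)) := by
        gcongr
        exact hiter.trans (by gcongr)
    _ = l ^ p * μ (DQ 0 v0) + A * K * (l ^ p * μ (DQ 0 v0) +
        A * (l ^ p * ∑' j, A ^ j * s j)) := by ring
    _ ≤ ENNReal.ofReal (2 ^ η) ^ p * X + A * K * (ENNReal.ofReal (2 ^ η) ^ p * X +
        A * (((1 + e⁻¹) * (γ ^ p)⁻¹) * X)) := by gcongr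
    _ = (ENNReal.ofReal (2 ^ η) ^ p + A * K * (ENNReal.ofReal (2 ^ η) ^ p +
        A * (((1 + e⁻¹)) * (γ ^ p)⁻¹))) * X := by ring
    _ ≤ _ := mul_le_mul' le_add_self le_rfl

lemma global_bound {n : ℕ} {η : ℝ} (hη : 0 < η) (p : ℝ) (hp : 0 < p)
    (μ : Measure (En n)) (d : ℝ) (hd0 : 0 < d) (hd1 : d < 1)
    (hμ : AInf μ (ENNReal.ofReal d)) :
    ∃ C : ℝ≥0∞, C ≠ ∞ ∧ ∀ f : En n → ℝ,
      ∫⁻ x, dyadicMax n η f x ^ p ∂μ ≤ C * ∫⁻ x, sharpMax n η f x ^ p ∂μ := by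
  -- choice of parameters
  set a : ℝ := d ^ (-(1 / (2 * p))) with ha
  have ha1 : 1 < a := Real.one_lt_rpow_of_pos_of_lt_one_of_neg hd0 hd1
    (by simp only [Left.neg_neg_iff]; positivity)
  have hap : a ^ p = d ^ (-(1 / 2) : ℝ) := by
    rw [ha, ← Real.rpow_mul hd0.le]
    congr 1
    field_simp
  have hap1 : 1 < a ^ p := Real.one_lt_rpow ha1 hp
  have hapd : a ^ p * d < 1 := by
    have : a ^ p * d = d ^ (1 / 2 : ℝ) := by
      rw [hap]
      nth_rewrite 2 [← Real.rpow_one d]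
      rw [← Real.rpow_add hd0]
      norm_num
    rw [this]
    exact Real.rpow_lt_one hd0.le hd1 (by norm_num)
  set b : ℝ≥0∞ := ENNReal.ofReal (a - 1) with hb
  set e : ℝ≥0∞ := ENNReal.ofReal (a ^ p - 1) with he
  have hb1 : 1 + b = ENNReal.ofReal a := by
    rw [hb, ← ENNReal.ofReal_one, ← ENNReal.ofReal_add (by norm_num) (by linarith)]
    congr 1; ring
  have hA : (1 + b) ^ p = ENNReal.ofReal (a ^ p) := by
    rw [hb1, ENNReal.ofReal_rpow_of_pos (by linarith)]
  have he1 : (1 + b) ^ p = 1 + e := by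
    rw [hA, he, ← ENNReal.ofReal_one, ← ENNReal.ofReal_add (by norm_num) (by linarith)]
    congr 1; ring
  have hb0 : b ≠ 0 := by
    rw [hb, ne_eq, ENNReal.ofReal_eq_zero]; linarith
  have hbt : b ≠ ∞ := ENNReal.ofReal_ne_top
  have he0 : e ≠ 0 := by
    rw [he, ne_eq, ENNReal.ofReal_eq_zero]; linarith
  have het : e ≠ ∞ := ENNReal.ofReal_ne_top
  set K : ℝ≥0∞ := ENNReal.ofReal (1 - a ^ p * d)⁻¹ with hKdef
  have hK : 1 + (1 + b) ^ p * ENNReal.ofReal d * K ≤ K := by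
    have h1 : 0 < 1 - a ^ p * d := by linarith
    rw [hA, ← ENNReal.ofReal_mul (by positivity), hKdef, ← ENNReal.ofReal_mul (by positivity),
      ← ENNReal.ofReal_one, ← ENNReal.ofReal_add (by norm_num) (by positivity)]
    refine ENNReal.ofReal_le_ofReal (le_of_eq ?_)
    field_simp
    ring
  set z : ℝ≥0∞ := 2 * (2 ^ n * (2 * ENNReal.ofReal (2 ^ η))) with hz
  have h2η : ENNReal.ofReal (2 ^ η) ≠ 0 := by
    have : (0 : ℝ) < 2 ^ η := by positivity
    simpa using this
  have hz0 : z ≠ 0 := by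
    rw [hz]
    exact mul_ne_zero two_ne_zero (mul_ne_zero (pow_ne_zero _ two_ne_zero)
      (mul_ne_zero two_ne_zero h2η))
  have hzt : z ≠ ∞ := by
    rw [hz]
    exact ENNReal.mul_ne_top (by simp) (ENNReal.mul_ne_top (ENNReal.pow_ne_top (by simp))
      (ENNReal.mul_ne_top (by simp) ENNReal.ofReal_ne_top))
  set γ : ℝ≥0∞ := b / z with hγdef
  have hγ0 : γ ≠ 0 := ENNReal.div_ne_zero.2 ⟨hb0, hzt⟩
  have hγt : γ ≠ ∞ := ENNReal.div_ne_top hbt hz0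
  have hγ : 2 * (2 ^ n * (2 * ENNReal.ofReal (2 ^ η) * γ)) ≤ b := by
    have : 2 * (2 ^ n * (2 * ENNReal.ofReal (2 ^ η) * γ)) = z * γ := by rw [hz]; ring
    rw [this, hγdef, ENNReal.mul_div_cancel hz0 hzt]
  have hγp0 : γ ^ p ≠ 0 := by simp [ENNReal.rpow_eq_zero_iff, hγ0, hγt]
  have hAt : (1 + b) ^ p ≠ ∞ := by rw [hA]; exact ENNReal.ofReal_ne_top
  have hDt : ENNReal.ofReal (2 ^ η) ^ p ≠ ∞ :=
    ENNReal.rpow_ne_top_of_nonneg hp.le ENNReal.ofReal_ne_top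
  have hKt : K ≠ ∞ := ENNReal.ofReal_ne_top
  set C0 : ℝ≥0∞ := (1 + (ENNReal.ofReal (2 ^ η) ^ p + (1 + b) ^ p * K *
    (ENNReal.ofReal (2 ^ η) ^ p + (1 + b) ^ p * (((1 + e⁻¹)) * (γ ^ p)⁻¹)))) with hC0
  have hC0t : C0 ≠ ∞ := by
    refine ENNReal.add_ne_top.2 ⟨ENNReal.one_ne_top, ENNReal.add_ne_top.2 ⟨hDt,
      ENNReal.mul_ne_top (ENNReal.mul_ne_top hAt hKt) (ENNReal.add_ne_top.2 ⟨hDt,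
      ENNReal.mul_ne_top hAt (ENNReal.mul_ne_top (ENNReal.add_ne_top.2 ⟨ENNReal.one_ne_top,
        ENNReal.inv_ne_top.2 he0⟩) (ENNReal.inv_ne_top.2 hγp0))⟩)⟩⟩
  refine ⟨1 + C0, ENNReal.add_ne_top.2 ⟨ENNReal.one_ne_top, hC0t⟩, fun f => ?_⟩
  have hun : (⋃ v : Fin n → ℤ, DQ 0 v) = (univ : Set (En n)) := by
    refine eq_univ_of_forall fun x => ?_
    obtain ⟨v, hv⟩ := exists_mem_DQ 0 x
    exact mem_iUnion.2 ⟨v, hv⟩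
  have hdis : Pairwise (Function.onFun Disjoint fun v : Fin n → ℤ => (DQ 0 v : Set (En n))) := by
    intro v w hvw
    exact Set.disjoint_left.2 fun x hx hx' => hvw (DQ_eq hx hx')
  have hsum : ∀ g : En n → ℝ≥0∞, ∫⁻ x, g x ∂μ = ∑' v : Fin n → ℤ, ∫⁻ x in DQ 0 v, g x ∂μ := by
    intro g
    rw [← lintegral_iUnion (fun v => meas_DQ _ _) hdis, hun, Measure.restrict_univ]
  have hDMb : ∫⁻ x, DM (ab f) x ^ p ∂μ ≤ C0 * ∫⁻ x, sharpMax n η f x ^ p ∂μ := by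
    rw [hsum, hsum fun x => sharpMax n η f x ^ p, ← ENNReal.tsum_mul_left]
    exact ENNReal.tsum_le_tsum fun v => local_bound hη p hp f μ _ hμ v b γ e K hb0 hbt hγ0 hγt hγ
      he1 he0 het hK
  calc _ ≤ ∫⁻ x, (sharpMax n η f x ^ p + DM (ab f) x ^ p) ∂μ := by
        refine lintegral_mono fun x => ?_
        refine (ENNReal.rpow_le_rpow (F1 hη f x) hp.le).trans ?_
        rcases max_choice (sharpMax n η f x) (DM (ab f) x) with h | h <;> rw [h]
        · exact le_self_add
        · exact le_add_self
    _ = ∫⁻ x, sharpMax n η f x ^ p ∂μ + ∫⁻ x, DM (ab f) x ^ p ∂μ :=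
        lintegral_add_left ((meas_sharpMax η f).pow_const p) _
    _ ≤ ∫⁻ x, sharpMax n η f x ^ p ∂μ + C0 * ∫⁻ x, sharpMax n η f x ^ p ∂μ := by gcongr
    _ = _ := by ring

lemma aInf_of_ap {n : ℕ} (p θ : ℝ) (hp : 1 < p) (hθ : 0 ≤ θ) (ω : En n → ℝ)
    (h : ApTheta n p θ ω) : ∃ d : ℝ, 0 < d ∧ d < 1 ∧
      AInf (volume.withDensity fun y => ENNReal.ofReal (ω y)) (ENNReal.ofReal d) := by
  obtain ⟨-, hloc, C, hC, hAp⟩ := h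
  have hp0 : 0 < p := by linarith
  have hpi : 0 < 1 / p := by positivity
  have hpi1 : 0 < 1 - 1 / p := by
    rw [sub_pos, div_lt_one hp0]; exact hp
  set W : En n → ℝ≥0∞ := fun y => ENNReal.ofReal (ω y) with hW
  have hWm : AEMeasurable W volume := hloc.aestronglyMeasurable.aemeasurable.ennreal_ofReal
  set κ : ℝ := (2 * (2 ^ θ * C)) ^ p with hκ
  have hκ0 : 0 < κ := by positivity
  refine ⟨κ / (1 + κ), by positivity, by rw [div_lt_one (by positivity)]; linarith, ?_⟩
  intro k v E hE hEQ hvol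
  set Q := DQ k v with hQ
  have hQm : MeasurableSet Q := meas_DQ _ _
  have hμ : ∀ s, MeasurableSet s → (volume.withDensity W) s = ∫⁻ y in s, W y :=
    fun s hs => withDensity_apply _ hs
  rw [hμ _ hE, hμ _ hQm]
  obtain ⟨c, hc⟩ := DQ_subset_cube k v
  set r : ℝ := 2 ^ (-(k : ℤ)) with hr
  have hr0 : 0 < r := by positivity
  have hr1 : r ≤ 1 := by
    rw [hr, zpow_neg, zpow_natCast]
    exact inv_le_one_of_one_le₀ (one_le_pow₀ (by norm_num))
  set V := volume Q with hV
  have hV0 : V ≠ 0 := vol_ne_zero _ _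
  have hVt : V ≠ ∞ := vol_ne_top _ _
  have hVc : volume (cube c r) = V := by rw [vol_cube, hV, hQ, vol_DQ]
  have hap := hAp c r hr0
  rw [if_neg hp.ne', hVc] at hap
  set I := ∫⁻ y in cube c r, W y with hI
  set J := ∫⁻ y in cube c r, W y ^ (-1 / (p - 1)) with hJ
  change ((ENNReal.ofReal ((1 + r) ^ θ) * V)⁻¹ * I) ^ (1 / p) *
    ((ENNReal.ofReal ((1 + r) ^ θ) * V)⁻¹ * J) ^ (1 - 1 / p) ≤ ENNReal.ofReal C at hap
  set D := ENNReal.ofReal ((1 + r) ^ θ) * V with hD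
  have h1r : 0 < (1 + r) ^ θ := by positivity
  have hD0 : D ≠ 0 := mul_ne_zero (by simpa using h1r) hV0
  have hDt : D ≠ ∞ := ENNReal.mul_ne_top ENNReal.ofReal_ne_top hVt
  have hIJ : I ^ (1 / p) * J ^ (1 - 1 / p) ≤ ENNReal.ofReal (2 ^ θ * C) * V := by
    have h1 : D⁻¹ * (I ^ (1 / p) * J ^ (1 - 1 / p)) ≤ ENNReal.ofReal C := by
      refine le_trans (le_of_eq ?_) hap
      rw [ENNReal.mul_rpow_of_nonneg _ _ hpi.le, ENNReal.mul_rpow_of_nonneg _ _ hpi1.le]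
      have h2 : D⁻¹ = D⁻¹ ^ (1 / p) * D⁻¹ ^ (1 - 1 / p) := by
        rw [← ENNReal.rpow_add _ _ (ENNReal.inv_ne_zero.2 hDt) (ENNReal.inv_ne_top.2 hD0)]
        simp
      nth_rewrite 1 [h2]
      ring
    calc _ = D * (D⁻¹ * (I ^ (1 / p) * J ^ (1 - 1 / p))) := by
          rw [← mul_assoc, ENNReal.mul_inv_cancel hD0 hDt, one_mul]
      _ ≤ D * ENNReal.ofReal C := by gcongr
      _ ≤ (ENNReal.ofReal (2 ^ θ) * V) * ENNReal.ofReal C := by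
          rw [hD]
          gcongr
          linarith
      _ = _ := by rw [ENNReal.ofReal_mul (by positivity)]; ring
  set μQ := ∫⁻ y in Q, W y with hμQ
  have hμQI : μQ ≤ I := lintegral_mono_set hc
  by_cases hμ0 : μQ = 0
  · rw [hμ0, mul_zero, ← hμ0]
    exact lintegral_mono_set hEQ
  have hμt : μQ ≠ ∞ := by
    have hb : Bornology.IsBounded Q := by
      refine Bornology.IsBounded.subset ?_ hc
      have : cube c r ⊆ WithLp.toLp 2 '' (Metric.closedBall (WithLp.ofLp c) (r / 2)) := by
        intro y hy
        refine ⟨WithLp.ofLp y, ?_, rfl⟩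
        rw [Metric.mem_closedBall, dist_pi_le_iff (by positivity)]
        intro i
        exact hy i
      exact ((isCompact_closedBall _ _).image
        (PiLp.continuous_toLp 2 _)).isBounded.subset this
    have hcomp : IsCompact (closure Q) := hb.isCompact_closure
    have hint : IntegrableOn ω Q := (hloc.integrableOn_isCompact hcomp).mono_set subset_closure
    have := hint.hasFiniteIntegral
    refine ne_of_lt (lt_of_le_of_lt ?_ this)
    refine lintegral_mono fun y => ?_
    rw [Real.enorm_eq_ofReal_abs]
    exact ENNReal.ofReal_le_ofReal (le_abs_self _)
  -- positivity of the weight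
  have hI0 : I ^ (1 / p) ≠ 0 := by
    intro h0
    rw [ENNReal.rpow_eq_zero_iff] at h0
    rcases h0 with ⟨h0, -⟩ | ⟨-, h0⟩
    · exact hμ0 (le_antisymm (hμQI.trans h0.le) zero_le)
    · linarith
  have hJt : J ≠ ∞ := by
    intro hJ'
    rw [hJ', ENNReal.top_rpow_of_pos hpi1, ENNReal.mul_top hI0, top_le_iff] at hIJ
    exact ENNReal.mul_ne_top ENNReal.ofReal_ne_top hVt hIJ
  have hWpos : ∀ᵐ y ∂(volume.restrict Q), W y ≠ 0 := by
    have h1 : ∀ᵐ y ∂(volume.restrict (cube c r)), W y ^ (-1 / (p - 1)) < ∞ :=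
      ae_lt_top' (hWm.restrict.pow_const _) hJt
    refine (ae_restrict_of_ae_restrict_of_subset hc h1).mono fun y hy h0 => ?_
    rw [h0, ENNReal.zero_rpow_of_neg (div_neg_of_neg_of_pos (by norm_num) (by linarith))] at hy
    exact lt_irrefl _ hy
  -- Hölder
  set F := Q \ E with hF
  have hFQ : F ⊆ Q := sdiff_subset
  have hFm : MeasurableSet F := hQm.diff hE
  set μF := ∫⁻ y in F, W y with hμF
  have hsplit : volume E + volume F = V := by
    rw [← measure_union disjoint_sdiff_right hFm, union_sdiff_cancel hEQ]
  have hVF : V ≤ 2 * volume F := by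
    have hEt : 2 * volume E ≠ ∞ := (hvol.trans_lt hVt.lt_top).ne
    have : 2 * volume E + V ≤ 2 * volume E + 2 * volume F := by
      rw [← mul_add, hsplit, two_mul V]
      exact add_le_add hvol le_rfl
    exact (ENNReal.add_le_add_iff_left hEt).1 this
  have hconj := Real.HolderConjugate.conjExponent hp
  have hhol : volume F ≤ μF ^ (1 / p) * J ^ (1 - 1 / p) := by
    have hq : 1 / p.conjExponent = 1 - 1 / p := by
      rw [Real.conjExponent]; field_simp
    have h1 := ENNReal.lintegral_mul_le_Lp_mul_Lq (volume.restrict F) hconj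
      (f := fun y => W y ^ (1 / p)) (g := fun y => W y ^ (-(1 / p)))
      (hWm.restrict.pow_const _) (hWm.restrict.pow_const _)
    have h2 : ∫⁻ y in F, ((fun y => W y ^ (1 / p)) * (fun y => W y ^ (-(1 / p)))) y = volume F := by
      rw [← setLIntegral_one]
      refine lintegral_congr_ae ?_
      refine (ae_restrict_of_ae_restrict_of_subset hFQ hWpos).mono fun y hy => ?_
      simp only [Pi.mul_apply]
      rw [← ENNReal.rpow_add _ _ hy ENNReal.ofReal_ne_top]
      simp
    have h3 : ∀ y, (W y ^ (1 / p)) ^ p = W y := by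
      intro y
      rw [← ENNReal.rpow_mul, one_div, inv_mul_cancel₀ hp0.ne', ENNReal.rpow_one]
    have h4 : ∀ y, (W y ^ (-(1 / p))) ^ p.conjExponent = W y ^ (-1 / (p - 1)) := by
      intro y
      rw [← ENNReal.rpow_mul, Real.conjExponent]
      congr 1
      field_simp
    rw [h2, hq] at h1
    simp only [h3, h4] at h1
    refine h1.trans ?_
    gcongr
    exact lintegral_mono_set (hFQ.trans hc)
  have hmain : μQ ≤ ENNReal.ofReal κ * μF := by
    have h1 : V * μQ ^ (1 / p) ≤ V * (ENNReal.ofReal (2 * (2 ^ θ * C)) * μF ^ (1 / p)) := by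
      calc V * μQ ^ (1 / p) ≤ 2 * (μF ^ (1 / p) * J ^ (1 - 1 / p)) * I ^ (1 / p) := by
            gcongr
            exact hVF.trans (by gcongr)
        _ = 2 * μF ^ (1 / p) * (I ^ (1 / p) * J ^ (1 - 1 / p)) := by ring
        _ ≤ 2 * μF ^ (1 / p) * (ENNReal.ofReal (2 ^ θ * C) * V) := by gcongr
        _ = _ := by
            rw [ENNReal.ofReal_mul (by norm_num : (0 : ℝ) ≤ 2), ENNReal.ofReal_ofNat]
            ring
    have h2 := (ENNReal.mul_le_mul_iff_right hV0 hVt).1 h1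
    have h3 := ENNReal.rpow_le_rpow h2 hp0.le
    rw [ENNReal.mul_rpow_of_nonneg _ _ hp0.le, ← ENNReal.rpow_mul, ← ENNReal.rpow_mul, one_div,
      inv_mul_cancel₀ hp0.ne', ENNReal.rpow_one, ENNReal.rpow_one,
      ENNReal.ofReal_rpow_of_pos (by positivity)] at h3
    exact h3
  -- conclusion
  set μE := ∫⁻ y in E, W y with hμE
  have hadd : μE + μF = μQ := by
    rw [hμE, hμF, hμQ, ← lintegral_union hFm disjoint_sdiff_right, hF, union_sdiff_cancel hEQ]
  have hfin : ENNReal.ofReal (1 + κ) * μE ≤ ENNReal.ofReal κ * μQ := by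
    have : ENNReal.ofReal κ * μE + μE + μF ≤ ENNReal.ofReal κ * μQ + μF := by
      calc _ = ENNReal.ofReal κ * μE + μQ := by rw [add_assoc, hadd]
        _ ≤ ENNReal.ofReal κ * μE + ENNReal.ofReal κ * μF := by gcongr
        _ = ENNReal.ofReal κ * μQ := by rw [← mul_add, hadd]
        _ ≤ _ := le_self_add
    have hFt : μF ≠ ∞ := ((le_add_self.trans hadd.le).trans_lt hμt.lt_top).ne
    have h2 := (ENNReal.add_le_add_iff_right hFt).1 this
    rw [ENNReal.ofReal_add (by norm_num) hκ0.le, ENNReal.ofReal_one, add_mul, one_mul, add_comm]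
    exact h2
  have h1κ : ENNReal.ofReal (1 + κ) ≠ 0 := by
    have : 0 < 1 + κ := by positivity
    simpa using this
  rw [ENNReal.ofReal_div_of_pos (by positivity)]
  rw [← ENNReal.mul_le_mul_iff_right h1κ ENNReal.ofReal_ne_top, ← mul_assoc,
    ENNReal.mul_div_cancel h1κ ENNReal.ofReal_ne_top]
  exact hfin

lemma exists_DQ_subset {n : ℕ} {U : Set (En n)} (hU : IsOpen U) {x : En n} (hx : x ∈ U) (k0 : ℕ) :
    ∃ k w, k0 ≤ k ∧ x ∈ DQ k w ∧ DQ k w ⊆ U := by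
  have hU' : IsOpen ((WithLp.toLp 2 : (Fin n → ℝ) → En n) ⁻¹' U) :=
    hU.preimage (PiLp.continuous_toLp 2 _)
  obtain ⟨ε, hε, hball⟩ := Metric.isOpen_iff.1 hU' (WithLp.ofLp x) hx
  obtain ⟨m, hm⟩ := exists_pow_lt_of_lt_one hε (by norm_num : (1 / 2 : ℝ) < 1)
  set k := max k0 m with hk
  obtain ⟨w, hw⟩ := exists_mem_DQ k x
  refine ⟨k, w, le_max_left _ _, hw, fun y hy => ?_⟩
  have : WithLp.ofLp y ∈ Metric.ball (WithLp.ofLp x) ε := by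
    rw [Metric.mem_ball, dist_pi_lt_iff hε]
    intro i
    have h1 := hw i
    have h2 := hy i
    have h3 : (2 : ℝ) ^ (-(k : ℤ)) ≤ (1 / 2) ^ m := by
      rw [zpow_neg, zpow_natCast, ← inv_pow, ← one_div]
      exact pow_le_pow_of_le_one (by norm_num) (by norm_num) (le_max_right _ _)
    rw [Real.dist_eq, abs_lt]
    constructor <;> nlinarith [h1.1, h1.2, h2.1, h2.2]
  exact hball this

lemma null_set {n : ℕ} {η : ℝ} (f : En n → ℝ) (hf : Measurable f) (s t : ℝ≥0∞) (hst : s < t)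
    (v : Fin n → ℤ) :
    volume (DQ 0 v ∩ {x | dyadicMax n η f x ≤ s ∧ t ≤ ab f x}) = 0 := by
  set E := DQ 0 v ∩ {x | dyadicMax n η f x ≤ s ∧ t ≤ ab f x} with hE
  have habm : Measurable (ab f) := (continuous_abs.measurable.comp hf).ennreal_ofReal
  have hEm : MeasurableSet E := (meas_DQ _ _).inter
    ((measurableSet_le (meas_dyadicMax _ _) measurable_const).inter
      (measurableSet_le measurable_const habm))
  have hEt : volume E ≠ ∞ :=
    ((measure_mono inter_subset_left).trans_lt (vol_ne_top _ _).lt_top).ne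
  obtain ⟨s', hs1, hs2⟩ := exists_between hst
  have hs't : s' ≠ ∞ := hs2.ne_top
  have hlim : Tendsto (fun k : ℕ => ENNReal.ofReal ((1 + (2 : ℝ) ^ (-(k : ℤ))) ^ η) * s) atTop
      (nhds s) := by
    have h1 : Tendsto (fun k : ℕ => (2 : ℝ) ^ (-(k : ℤ))) atTop (nhds 0) := by
      have := tendsto_pow_atTop_nhds_zero_of_lt_one (r := (1 / 2 : ℝ)) (by norm_num) (by norm_num)
      refine this.congr fun k => ?_
      rw [zpow_neg, zpow_natCast, one_div, inv_pow]
    have h2 : Tendsto (fun k : ℕ => (1 + (2 : ℝ) ^ (-(k : ℤ))) ^ η) atTop (nhds 1) := by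
      have := (h1.const_add 1).rpow_const (p := η) (Or.inl (by norm_num))
      simpa using this
    have h3 := ENNReal.Tendsto.mul_const (b := s) (ENNReal.tendsto_ofReal h2) (Or.inr hst.ne_top)
    simpa using h3
  obtain ⟨k0, hk0⟩ := eventually_atTop.1 (hlim.eventually (eventually_le_nhds hs1))
  have hopen : ∀ U, IsOpen U → E ⊆ U → t * volume E ≤ s' * volume U := by
    intro U hU hEU
    obtain ⟨T, hT1, -, hT3, hT4⟩ :=
      stopping (fun k w => k0 ≤ k ∧ DQ k w ⊆ U ∧ (DQ k w ∩ E).Nonempty)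
    have hc : T.Countable := T.to_countable
    have hET : E ⊆ ⋃ q ∈ T, DQ q.1 q.2 := by
      intro x hx
      obtain ⟨k, w, h1, h2, h3⟩ := exists_DQ_subset hU (hEU hx) k0
      exact hT4 k w ⟨h1, h3, x, h2, hx⟩ h2
    calc t * volume E = ∫⁻ _ in E, t := by
          rw [lintegral_const, Measure.restrict_apply_univ]
      _ ≤ ∫⁻ y in E, ab f y := setLIntegral_mono' hEm fun x hx => hx.2.2
      _ ≤ ∫⁻ y in ⋃ q ∈ T, DQ q.1 q.2, ab f y := lintegral_mono_set hET
      _ = ∑' q : T, ∫⁻ y in DQ q.1.1 q.1.2, ab f y :=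
          lintegral_biUnion hc (fun q _ => meas_DQ _ _) hT3 _
      _ ≤ ∑' q : T, s' * volume (DQ q.1.1 q.1.2) := by
          refine ENNReal.tsum_le_tsum ?_
          rintro ⟨⟨k, w⟩, hq⟩
          obtain ⟨hk, -, x, hx, hxE⟩ := hT1 _ hq
          dsimp only at hk hx ⊢
          have h1 : (ENNReal.ofReal ((1 + (2 : ℝ) ^ (-(k : ℤ))) ^ η) * volume (DQ k w))⁻¹ *
              ∫⁻ y in DQ k w, ab f y ≤ s := by
            refine le_trans ?_ hxE.2.1
            exact le_iSup_of_le (k : ℤ) (le_iSup_of_le w (le_iSup_of_le hx le_rfl))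
          set D := ENNReal.ofReal ((1 + (2 : ℝ) ^ (-(k : ℤ))) ^ η) * volume (DQ k w) with hD
          have hpos : (0 : ℝ) < (1 + (2 : ℝ) ^ (-(k : ℤ))) ^ η := by positivity
          have hD0 : D ≠ 0 := mul_ne_zero (by simpa using hpos) (vol_ne_zero _ _)
          have hDt : D ≠ ∞ := ENNReal.mul_ne_top ENNReal.ofReal_ne_top (vol_ne_top _ _)
          calc ∫⁻ y in DQ k w, ab f y = D * (D⁻¹ * ∫⁻ y in DQ k w, ab f y) := by
                rw [← mul_assoc, ENNReal.mul_inv_cancel hD0 hDt, one_mul]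
            _ ≤ D * s := by gcongr
            _ = (ENNReal.ofReal ((1 + (2 : ℝ) ^ (-(k : ℤ))) ^ η) * s) * volume (DQ k w) := by
                rw [hD]; ring
            _ ≤ s' * volume (DQ k w) := mul_le_mul' (hk0 k hk) le_rfl
      _ = s' * volume (⋃ q ∈ T, DQ q.1 q.2) := by
          rw [measure_biUnion hc hT3 fun q _ => meas_DQ _ _, ENNReal.tsum_mul_left]
      _ ≤ s' * volume U := by
          gcongr
          exact iUnion₂_subset fun q hq => (hT1 q hq).2.1
  by_contra hne
  have hlt : s' * volume E < t * volume E := by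
    exact (ENNReal.mul_lt_mul_iff_left hne hEt).2 hs2
  have hs'0 : s' ≠ 0 := (lt_of_le_of_lt zero_le hs1).ne'
  have hlt' : volume E < t * volume E / s' := by
    rw [ENNReal.lt_div_iff_mul_lt (Or.inl hs'0) (Or.inl hs't), mul_comm]
    exact hlt
  obtain ⟨U, hEU, hU, hUlt⟩ := E.exists_isOpen_lt_of_lt _ hlt'
  rw [ENNReal.lt_div_iff_mul_lt (Or.inl hs'0) (Or.inl hs't), mul_comm] at hUlt
  exact absurd hUlt (not_lt.2 (hopen U hU hEU))

lemma ae_le_dyadicMax {n : ℕ} {η : ℝ} (f : En n → ℝ) (hf : Measurable f) :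
    ∀ᵐ x, ab f x ≤ dyadicMax n η f x := by
  have h : ∀ᵐ x : En n, ∀ (v : Fin n → ℤ) (s t : ℚ),
      ENNReal.ofReal s < ENNReal.ofReal t →
      ¬ (x ∈ DQ 0 v ∩ {x | dyadicMax n η f x ≤ ENNReal.ofReal s ∧ ENNReal.ofReal t ≤ ab f x}) := by
    rw [ae_all_iff]; intro v
    rw [ae_all_iff]; intro s
    rw [ae_all_iff]; intro t
    by_cases hst : ENNReal.ofReal s < ENNReal.ofReal t
    · have := measure_eq_zero_iff_ae_notMem.1 (null_set (η := η) f hf _ _ hst v)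
      exact this.mono fun x hx _ => hx
    · exact Eventually.of_forall fun x hc => absurd hc hst
  refine h.mono fun x hx => ?_
  by_contra hlt
  rw [not_le] at hlt
  obtain ⟨s, -, hs1, hs2⟩ := ENNReal.lt_iff_exists_rat_btwn.1 hlt
  obtain ⟨t, -, ht1, ht2⟩ := ENNReal.lt_iff_exists_rat_btwn.1 hs2
  obtain ⟨v, hv⟩ := exists_mem_DQ 0 x
  exact hx v s t ht1 ⟨hv, hs1.le, ht2.le⟩

end FS13

/-- Lemma 2.4: for `ω ∈ A_p^∞(φ)` and `f ∈ L^p(ω)`,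
`‖f‖_{L^p(ω)} ≤ ‖M^△_{φ,η} f‖_{L^p(ω)} ≤ C ‖M^{♯,△}_{φ,η} f‖_{L^p(ω)}`. -/
theorem stmt13 (n : ℕ) (hn : 0 < n) (p η : ℝ) (hp : 1 < p) (hη : 0 < η)
    (ω : En n → ℝ) (hω : ∃ θ ≥ 0, ApTheta n p θ ω) :
    ∃ C > 0, ∀ f : En n → ℝ, Measurable f → wLp p ω f < ∞ →
      wLp p ω f ≤ wLpE n p ω (dyadicMax n η f) ∧
        wLpE n p ω (dyadicMax n η f) ≤
          ENNReal.ofReal C * wLpE n p ω (sharpMax n η f) := by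
  obtain ⟨θ, hθ, hAp⟩ := hω
  have hp0 : 0 < p := by linarith
  have hW0 := hAp.1
  have hWm : AEMeasurable (fun y => ENNReal.ofReal (ω y)) volume :=
    hAp.2.1.aestronglyMeasurable.aemeasurable.ennreal_ofReal
  obtain ⟨d, hd0, hd1, hA⟩ := FS13.aInf_of_ap p θ hp hθ ω hAp
  obtain ⟨C, hC, hbound⟩ := FS13.global_bound hη p hp0 _ d hd0 hd1 hA
  have hwd : ∀ g : En n → ℝ≥0∞, Measurable g →
      ∫⁻ x, g x ^ p * ENNReal.ofReal (ω x) =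
        ∫⁻ x, g x ^ p ∂(volume.withDensity fun y => ENNReal.ofReal (ω y)) := by
    intro g hg
    rw [lintegral_withDensity_eq_lintegral_mul₀ hWm (hg.pow_const p).aemeasurable]
    refine lintegral_congr fun x => ?_
    rw [Pi.mul_apply, mul_comm]
  refine ⟨(C ^ (1 / p)).toReal + 1, by positivity, fun f hf _ => ⟨?_, ?_⟩⟩
  · unfold wLp wLpE
    refine ENNReal.rpow_le_rpow (lintegral_mono_ae ?_) (by positivity)
    refine (FS13.ae_le_dyadicMax (η := η) f hf).mono fun x hx => ?_
    rw [ENNReal.ofReal_mul (by positivity), ← ENNReal.ofReal_rpow_of_nonneg (abs_nonneg _) hp0.le]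
    gcongr
  · unfold wLpE
    rw [hwd _ (FS13.meas_dyadicMax η f), hwd _ (FS13.meas_sharpMax η f)]
    refine (ENNReal.rpow_le_rpow (hbound f) (by positivity : (0 : ℝ) ≤ 1 / p)).trans ?_
    rw [ENNReal.mul_rpow_of_nonneg _ _ (by positivity)]
    gcongr
    have hCt : C ^ (1 / p) ≠ ∞ := ENNReal.rpow_ne_top_of_nonneg (by positivity) hC
    rw [ENNReal.ofReal_add ENNReal.toReal_nonneg zero_le_one, ENNReal.ofReal_toReal hCt]
    exact le_self_add

end
end

section
/- Let 0 < η < ∞, ω ∈ A_∞^∞(φ), δ > 0, and let ψ : (0,∞) → (0,∞) be doubling, i.e. there is C₀ with ψ(2a) ≤ C₀ ψ(a) for all a > 0. Then there exists a constant C, depending on the doubling constant of ψ and on ω, such that sup_{λ>0} ψ(λ) ω({y ∈ ℝⁿ : M^△_{δ,φ,η} f(y) > λ}) ≤ C sup_{λ>0} ψ(λ) ω({y ∈ ℝⁿ : M^{♯,△}_{δ,φ,η} f(y) > λ}) for all measurable f. -/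
open MeasureTheory ENNReal Set Filter

noncomputable section

/-! ### Geometry of dyadic cubes -/

theorem mem_dy {n : ℕ} {k : ℤ} {v : Fin n → ℤ} {x : En n} :
    x ∈ dyadicCube n k v ↔ ∀ i, ⌊x i * 2 ^ k⌋ = v i := by
  unfold dyadicCube
  simp only [mem_ofPred_eq]
  refine forall_congr' fun i => ?_
  have h2 : (0 : ℝ) < 2 ^ k := by positivity
  rw [Int.floor_eq_iff, zpow_neg, ← div_eq_mul_inv, ← div_eq_mul_inv, div_le_iff₀ h2,
    lt_div_iff₀ h2]

theorem floor_nest (a b : ℝ) (k k' : ℤ) (h : k ≤ k') (hab : ⌊a * 2 ^ k'⌋ = ⌊b * 2 ^ k'⌋) :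
    ⌊a * 2 ^ k⌋ = ⌊b * 2 ^ k⌋ := by
  obtain ⟨m, rfl⟩ := Int.le.dest h
  have key : ∀ c : ℝ, ⌊c * 2 ^ k⌋ = ⌊c * 2 ^ (k + (m : ℤ))⌋ / ((2 ^ m : ℕ) : ℤ) := by
    intro c
    rw [← Int.floor_div_natCast]
    congr 1
    rw [zpow_add₀ (by norm_num)]
    push_cast
    rw [zpow_natCast]
    field_simp
  rw [key a, key b, hab]

theorem dy_nest {n : ℕ} {k k' : ℤ} {v v' : Fin n → ℤ} (h : k ≤ k') {x : En n}
    (hx : x ∈ dyadicCube n k v) (hx' : x ∈ dyadicCube n k' v') :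
    dyadicCube n k' v' ⊆ dyadicCube n k v := by
  intro y hy
  rw [mem_dy] at *
  intro i
  rw [← hx i]
  exact floor_nest _ _ _ _ h (by rw [hy i, hx' i])

theorem dy_eq {n : ℕ} {k : ℤ} {v v' : Fin n → ℤ} {x : En n}
    (hx : x ∈ dyadicCube n k v) (hx' : x ∈ dyadicCube n k v') : v = v' := by
  rw [mem_dy] at *
  funext i
  rw [← hx i, hx' i]

theorem dy_exists {n : ℕ} (k : ℤ) (x : En n) : ∃ v, x ∈ dyadicCube n k v :=
  ⟨fun i => ⌊x i * 2 ^ k⌋, mem_dy.2 fun _ => rfl⟩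

theorem dy_nonempty {n : ℕ} (k : ℤ) (v : Fin n → ℤ) : (dyadicCube n k v).Nonempty := by
  refine ⟨WithLp.toLp 2 fun i => (v i : ℝ) * 2 ^ (-k), fun i => ⟨le_rfl, ?_⟩⟩
  have : (0 : ℝ) < 2 ^ (-k) := by positivity
  simp only
  nlinarith

theorem dy_preimage {n : ℕ} (k : ℤ) (v : Fin n → ℤ) :
    dyadicCube n k v = (WithLp.ofLp : En n → (Fin n → ℝ)) ⁻¹'
      (univ.pi fun i => Ico ((v i : ℝ) * 2 ^ (-k)) (((v i : ℝ) + 1) * 2 ^ (-k))) := by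
  ext y
  simp [dyadicCube]

theorem dy_meas {n : ℕ} (k : ℤ) (v : Fin n → ℤ) : MeasurableSet (dyadicCube n k v) := by
  rw [dy_preimage]
  exact (PiLp.volume_preserving_ofLp (Fin n)).measurable
    (MeasurableSet.univ_pi fun i => measurableSet_Ico)

theorem dy_vol {n : ℕ} (k : ℤ) (v : Fin n → ℤ) :
    volume (dyadicCube n k v) = ENNReal.ofReal ((2 : ℝ) ^ (-k)) ^ n := by
  rw [dy_preimage, (PiLp.volume_preserving_ofLp (Fin n)).measure_preimage
    (MeasurableSet.univ_pi fun i => measurableSet_Ico).nullMeasurableSet, Real.volume_pi_Ico]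
  have : ∀ i, ((v i : ℝ) + 1) * 2 ^ (-k) - (v i : ℝ) * 2 ^ (-k) = 2 ^ (-k) := fun i => by ring
  simp only [this, Finset.prod_const, Finset.card_univ, Fintype.card_fin]

theorem dy_vol_ne_zero {n : ℕ} (k : ℤ) (v : Fin n → ℤ) : volume (dyadicCube n k v) ≠ 0 := by
  rw [dy_vol]
  refine pow_ne_zero _ ?_
  have : (0 : ℝ) < 2 ^ (-k) := by positivity
  simpa using this

theorem dy_vol_ne_top {n : ℕ} (k : ℤ) (v : Fin n → ℤ) : volume (dyadicCube n k v) ≠ ∞ := by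
  rw [dy_vol]
  exact ENNReal.pow_ne_top ENNReal.ofReal_ne_top

theorem dy_vol_parent {n : ℕ} (k : ℤ) (v v' : Fin n → ℤ) :
    volume (dyadicCube n k v) = 2 ^ n * volume (dyadicCube n (k + 1) v') := by
  rw [dy_vol, dy_vol, ← mul_pow]
  congr 1
  rw [← ENNReal.ofReal_ofNat, ← ENNReal.ofReal_mul (by norm_num)]
  congr 1
  rw [neg_add, zpow_add₀ (by norm_num)]
  norm_num
  ring

theorem cube_preimage {n : ℕ} (x : En n) (r : ℝ) :
    cube x r = (WithLp.ofLp : En n → (Fin n → ℝ)) ⁻¹'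
      (Icc (fun i => x i - r / 2) (fun i => x i + r / 2)) := by
  ext y
  simp only [cube, mem_ofPred_eq, mem_preimage, mem_Icc, Pi.le_def, ← forall_and]
  refine forall_congr' fun i => ?_
  rw [abs_le]
  constructor <;> rintro ⟨h1, h2⟩ <;> constructor <;> linarith

theorem cube_vol {n : ℕ} (x : En n) (r : ℝ) :
    volume (cube x r) = ENNReal.ofReal r ^ n := by
  rw [cube_preimage, (PiLp.volume_preserving_ofLp (Fin n)).measure_preimage
    measurableSet_Icc.nullMeasurableSet, Real.volume_Icc_pi]
  have : ∀ i, (x i + r / 2) - (x i - r / 2) = r := fun i => by ring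
  simp [this]

theorem cube_meas {n : ℕ} (x : En n) (r : ℝ) : MeasurableSet (cube x r) := by
  rw [cube_preimage]
  exact (PiLp.volume_preserving_ofLp (Fin n)).measurable measurableSet_Icc

theorem cube_compact {n : ℕ} (x : En n) (r : ℝ) : IsCompact (cube x r) := by
  rw [cube_preimage]
  exact (EuclideanSpace.equiv (Fin n) ℝ).toHomeomorph.isClosedEmbedding.isCompact_preimage
    isCompact_Icc

theorem dy_sub_cube {n : ℕ} (k : ℤ) (v : Fin n → ℤ) :
    dyadicCube n k v ⊆
      cube (WithLp.toLp 2 fun i => ((v i : ℝ) + 1 / 2) * 2 ^ (-k)) ((2 : ℝ) ^ (-k)) := by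
  intro y hy i
  have := hy i
  rw [abs_le]
  simp only
  constructor <;> nlinarith [this.1, this.2]

/-- Selection of maximal dyadic cubes. -/
theorem dy_select {n : ℕ} (S : Set (ℕ × (Fin n → ℤ))) :
    ∃ J : Set (ℕ × (Fin n → ℤ)), J ⊆ S ∧
      J.PairwiseDisjoint (fun q => dyadicCube n q.1 q.2) ∧
      (⋃ q ∈ S, dyadicCube n q.1 q.2) = (⋃ q ∈ J, dyadicCube n q.1 q.2) ∧
      ∀ q ∈ J, ∀ q' ∈ S, q'.1 < q.1 → ¬ dyadicCube n q.1 q.2 ⊆ dyadicCube n q'.1 q'.2 := by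
  refine ⟨{q | q ∈ S ∧ ∀ q' ∈ S, q'.1 < q.1 →
    ¬ dyadicCube n q.1 q.2 ⊆ dyadicCube n q'.1 q'.2}, fun q hq => hq.1, ?_, ?_,
    fun q hq => hq.2⟩
  · have key : ∀ q q' : ℕ × (Fin n → ℤ), q ∈ S → (∀ q'' ∈ S, q''.1 < q'.1 →
        ¬ dyadicCube n q'.1 q'.2 ⊆ dyadicCube n q''.1 q''.2) → q.1 ≤ q'.1 →
        ∀ x, x ∈ dyadicCube n q.1 q.2 → x ∈ dyadicCube n q'.1 q'.2 → q = q' := by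
      intro q q' hq hq' hle x hx hx'
      rcases hle.lt_or_eq with h | h
      · exact absurd (dy_nest (by exact_mod_cast hle) hx hx') (hq' q hq h)
      · obtain ⟨k, v⟩ := q
        obtain ⟨k', v'⟩ := q'
        simp only at h
        subst h
        exact Prod.ext rfl (dy_eq hx hx')
    intro q hq q' hq' hne
    rw [Function.onFun, Set.disjoint_left]
    intro x hx hx'
    rcases le_total q.1 q'.1 with h | h
    · exact hne (key q q' hq.1 hq'.2 h x hx hx')
    · exact hne (key q' q hq'.1 hq.2 h x hx' hx).symm
  · apply subset_antisymm
    · intro x hx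
      have hex : ∃ k : ℕ, ∃ v, (k, v) ∈ S ∧ x ∈ dyadicCube n k v := by
        simp only [mem_iUnion] at hx
        obtain ⟨q, hq, hxq⟩ := hx
        exact ⟨q.1, q.2, hq, hxq⟩
      classical
      obtain ⟨v, hv, hxv⟩ := Nat.find_spec hex
      simp only [mem_iUnion]
      refine ⟨(Nat.find hex, v), ⟨hv, ?_⟩, hxv⟩
      intro q' hq' hlt hsub
      exact Nat.find_min hex hlt ⟨q'.2, hq', hsub hxv⟩
    · exact biUnion_mono (fun q hq => hq.1) fun _ _ => subset_rfl

/-! ### The weight -/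

theorem weight_lower {n : ℕ} {p θ : ℝ} (hp : 1 ≤ p) (hθ : 0 ≤ θ) {ω : En n → ℝ}
    (hω : ApTheta n p θ ω) :
    ∃ K : ℝ, 1 ≤ K ∧ ∀ (k : ℕ) (v : Fin n → ℤ) (F : Set (En n)), MeasurableSet F →
      F ⊆ dyadicCube n k v → volume (dyadicCube n k v) ≤ 2 * volume F →
      ∫⁻ y in dyadicCube n k v, ENNReal.ofReal (ω y) ≤
        ENNReal.ofReal K * ∫⁻ y in F, ENNReal.ofReal (ω y) := by
  obtain ⟨h0, hloc, C, hC, H⟩ := hω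
  have hWm : AEMeasurable (fun y => ENNReal.ofReal (ω y)) volume :=
    hloc.aestronglyMeasurable.aemeasurable.ennreal_ofReal
  have h2θ : (1 : ℝ) ≤ 2 ^ θ := Real.one_le_rpow (by norm_num) hθ
  refine ⟨max 1 ((2 ^ θ * C * 2) ^ p), le_max_left _ _, ?_⟩
  intro k v F hF hFD hvol
  set D := dyadicCube n k v with hD
  set x : En n := WithLp.toLp 2 fun i => ((v i : ℝ) + 1 / 2) * 2 ^ (-(k : ℤ)) with hx
  set r : ℝ := (2 : ℝ) ^ (-(k : ℤ)) with hr
  have hr0 : 0 < r := by positivity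
  have hr1 : r ≤ 1 := by
    rw [hr, zpow_neg, zpow_natCast]
    exact inv_le_one_of_one_le₀ (one_le_pow₀ (by norm_num))
  have hDQ : D ⊆ cube x r := dy_sub_cube k v
  have hvQ : volume (cube x r) = volume D := by rw [cube_vol, hD, dy_vol]
  have hV0 : volume D ≠ 0 := dy_vol_ne_zero _ _
  have hVt : volume D ≠ ∞ := dy_vol_ne_top _ _
  have hφ : (1 + r) ^ θ ≤ 2 ^ θ := Real.rpow_le_rpow (by positivity) (by linarith) hθ
  have hφ0 : 0 < (1 + r) ^ θ := by positivity
  set T : ℝ≥0∞ := ENNReal.ofReal ((1 + r) ^ θ) * volume (cube x r) with hT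
  have hT0 : T ≠ 0 := by
    rw [hT, hvQ]; exact mul_ne_zero (by simpa using hφ0) hV0
  have hTt : T ≠ ∞ := by
    rw [hT, hvQ]; exact ENNReal.mul_ne_top ENNReal.ofReal_ne_top hVt
  have hTle : T ≤ ENNReal.ofReal (2 ^ θ) * (2 * volume F) := by
    rw [hT, hvQ]; gcongr
  have hH := H x r hr0
  by_cases hp1 : p = 1
  · rw [if_pos hp1] at hH
    set m := essInf (fun y => ENNReal.ofReal (ω y)) (volume.restrict (cube x r)) with hm
    have hmF : m * volume F ≤ ∫⁻ y in F, ENNReal.ofReal (ω y) := by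
      rw [← setLIntegral_const]
      refine lintegral_mono_ae ?_
      have : ∀ᵐ y ∂(volume.restrict (cube x r)), m ≤ ENNReal.ofReal (ω y) := ae_essInf_le
      exact ae_restrict_of_ae_restrict_of_subset (hFD.trans hDQ) this
    rw [ENNReal.inv_mul_le_iff hT0 hTt] at hH
    calc ∫⁻ y in D, ENNReal.ofReal (ω y) ≤ ∫⁻ y in cube x r, ENNReal.ofReal (ω y) :=
          lintegral_mono_set hDQ
      _ ≤ T * (ENNReal.ofReal C * m) := hH
      _ ≤ ENNReal.ofReal (2 ^ θ) * (2 * volume F) * (ENNReal.ofReal C * m) := by gcongr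
      _ = ENNReal.ofReal ((2 ^ θ * C * 2)) * (m * volume F) := by
          rw [ENNReal.ofReal_mul (by positivity), ENNReal.ofReal_mul (by positivity),
            ENNReal.ofReal_ofNat]
          ring
      _ ≤ ENNReal.ofReal (max 1 ((2 ^ θ * C * 2) ^ p)) * ∫⁻ y in F, ENNReal.ofReal (ω y) := by
          gcongr
          rw [hp1, Real.rpow_one]
          exact le_max_right _ _
  · rw [if_neg hp1] at hH
    have hp' : 1 < p := lt_of_le_of_ne hp (Ne.symm hp1)
    have hp0 : 0 < p := by linarith
    have hq0 : 0 < 1 - 1 / p := by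
      rw [sub_pos, div_lt_one hp0]; exact hp'
    set Sg := ∫⁻ y in cube x r, ENNReal.ofReal (ω y) ^ (-1 / (p - 1)) with hS
    set I := ∫⁻ y in cube x r, ENNReal.ofReal (ω y) with hI
    have hDI : ∫⁻ y in D, ENNReal.ofReal (ω y) ≤ I := lintegral_mono_set hDQ
    have hmain : I ^ (1 / p) * Sg ^ (1 - 1 / p) ≤ T * ENNReal.ofReal C := by
      rw [ENNReal.mul_rpow_of_nonneg _ _ (by positivity),
        ENNReal.mul_rpow_of_nonneg _ _ hq0.le] at hH
      have e : T⁻¹ ^ (1 / p) * I ^ (1 / p) * (T⁻¹ ^ (1 - 1 / p) * Sg ^ (1 - 1 / p))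
          = T⁻¹ * (I ^ (1 / p) * Sg ^ (1 - 1 / p)) := by
        have : T⁻¹ = T⁻¹ ^ (1 / p) * T⁻¹ ^ (1 - 1 / p) := by
          rw [← ENNReal.rpow_add _ _ (ENNReal.inv_ne_zero.2 hTt) (ENNReal.inv_ne_top.2 hT0)]
          simp
        conv_rhs => rw [this]
        ring
      rw [e, ENNReal.inv_mul_le_iff hT0 hTt] at hH
      exact hH
    by_cases hI0 : I = 0
    · have : ∫⁻ y in D, ENNReal.ofReal (ω y) = 0 := le_antisymm (hDI.trans hI0.le) bot_le
      rw [this]; exact bot_le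
    have hIp : I ^ (1 / p) ≠ 0 := by
      intro h
      rw [ENNReal.rpow_eq_zero_iff_of_pos (by positivity)] at h
      exact hI0 h
    have hSt : Sg ≠ ∞ := by
      intro h
      rw [h, ENNReal.top_rpow_of_pos hq0, ENNReal.mul_top hIp, top_le_iff] at hmain
      exact ENNReal.mul_ne_top hTt ENNReal.ofReal_ne_top hmain
    have hWm' : AEMeasurable (fun y => ENNReal.ofReal (ω y) ^ (-1 / (p - 1)))
        (volume.restrict (cube x r)) := (hWm.restrict).pow_const _
    have hpos : ∀ᵐ y ∂(volume.restrict F), ENNReal.ofReal (ω y) ≠ 0 := by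
      have := ae_lt_top' hWm' hSt
      have := ae_restrict_of_ae_restrict_of_subset (hFD.trans hDQ) this
      filter_upwards [this] with y hy h
      rw [h, ENNReal.zero_rpow_of_neg (div_neg_of_neg_of_pos (by norm_num) (by linarith))] at hy
      exact absurd hy (lt_irrefl _)
    have hconj : p.HolderConjugate (p / (p - 1)) := Real.HolderConjugate.conjExponent hp'
    have hqe : 1 / (p / (p - 1)) = 1 - 1 / p := by
      have : p - 1 ≠ 0 := by linarith
      field_simp
    have hold := ENNReal.lintegral_mul_le_Lp_mul_Lq (volume.restrict F) hconj
      (f := fun y => ENNReal.ofReal (ω y) ^ (1 / p))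
      (g := fun y => ENNReal.ofReal (ω y) ^ (-(1 / p)))
      (hWm.restrict.pow_const _) (hWm.restrict.pow_const _)
    have e1 : ∫⁻ y in F, ((fun y => ENNReal.ofReal (ω y) ^ (1 / p)) *
        (fun y => ENNReal.ofReal (ω y) ^ (-(1 / p)))) y = volume F := by
      rw [← setLIntegral_one]
      refine lintegral_congr_ae ?_
      filter_upwards [hpos] with y hy
      simp only [Pi.mul_apply]
      rw [← ENNReal.rpow_add _ _ hy ENNReal.ofReal_ne_top]
      simp
    have e2 : ∀ y, (ENNReal.ofReal (ω y) ^ (1 / p)) ^ p = ENNReal.ofReal (ω y) := by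
      intro y
      rw [← ENNReal.rpow_mul, one_div, inv_mul_cancel₀ hp0.ne', ENNReal.rpow_one]
    have e3 : ∀ y, (ENNReal.ofReal (ω y) ^ (-(1 / p))) ^ (p / (p - 1)) =
        ENNReal.ofReal (ω y) ^ (-1 / (p - 1)) := by
      intro y
      rw [← ENNReal.rpow_mul]
      congr 1
      have : p - 1 ≠ 0 := by linarith
      field_simp
    rw [e1, hqe] at hold
    simp only [e2, e3] at hold
    have hSF : ∫⁻ y in F, ENNReal.ofReal (ω y) ^ (-1 / (p - 1)) ≤ Sg :=
      lintegral_mono_set (hFD.trans hDQ)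
    set IF := ∫⁻ y in F, ENNReal.ofReal (ω y) with hIF
    have hold2 : volume F ≤ IF ^ (1 / p) * Sg ^ (1 - 1 / p) :=
      hold.trans (by gcongr)
    have hF0 : volume F ≠ 0 := by
      intro h
      rw [h, mul_zero] at hvol
      exact hV0 (le_antisymm hvol bot_le)
    have hS0 : Sg ^ (1 - 1 / p) ≠ 0 := by
      intro h
      rw [h, mul_zero] at hold2
      exact hF0 (le_antisymm hold2 bot_le)
    have hSt' : Sg ^ (1 - 1 / p) ≠ ∞ := ENNReal.rpow_ne_top_of_nonneg hq0.le hSt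
    have hfin : I ^ (1 / p) * Sg ^ (1 - 1 / p) ≤
        (ENNReal.ofReal (2 ^ θ * C * 2) * IF ^ (1 / p)) * Sg ^ (1 - 1 / p) := by
      calc I ^ (1 / p) * Sg ^ (1 - 1 / p) ≤ T * ENNReal.ofReal C := hmain
        _ ≤ ENNReal.ofReal (2 ^ θ) * (2 * (IF ^ (1 / p) * Sg ^ (1 - 1 / p))) * ENNReal.ofReal C := by
          refine mul_le_mul_left (hTle.trans ?_) _
          gcongr
        _ = _ := by
          rw [ENNReal.ofReal_mul (by positivity), ENNReal.ofReal_mul (by positivity),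
            ENNReal.ofReal_ofNat]
          ring
    rw [ENNReal.mul_le_mul_iff_left hS0 hSt'] at hfin
    have := ENNReal.rpow_le_rpow hfin hp0.le
    rw [ENNReal.mul_rpow_of_nonneg _ _ hp0.le, ← ENNReal.rpow_mul, ← ENNReal.rpow_mul, one_div,
      inv_mul_cancel₀ hp0.ne', ENNReal.rpow_one, ENNReal.rpow_one,
      ENNReal.ofReal_rpow_of_nonneg (by positivity) hp0.le] at this
    refine hDI.trans (this.trans ?_)
    gcongr
    exact le_max_right _ _

theorem weight_small {n : ℕ} {p θ : ℝ} (hp : 1 ≤ p) (hθ : 0 ≤ θ) {ω : En n → ℝ}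
    (hω : ApTheta n p θ ω) :
    ∃ ε : ℝ, 0 ≤ ε ∧ ε < 1 ∧ ∀ (k : ℕ) (v : Fin n → ℤ) (E : Set (En n)), MeasurableSet E →
      E ⊆ dyadicCube n k v → 2 * volume E ≤ volume (dyadicCube n k v) →
      volume.withDensity (fun y => ENNReal.ofReal (ω y)) E ≤
        ENNReal.ofReal ε * volume.withDensity (fun y => ENNReal.ofReal (ω y))
          (dyadicCube n k v) := by
  obtain ⟨K, hK1, hK⟩ := weight_lower hp hθ hω
  have hK0 : 0 < K := by linarith
  refine ⟨1 - K⁻¹, by rw [sub_nonneg]; exact inv_le_one_of_one_le₀ hK1,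
    by simpa using hK0, ?_⟩
  intro k v E hE hED hvol
  set μ := volume.withDensity (fun y => ENNReal.ofReal (ω y)) with hμ
  set D := dyadicCube n k v with hD
  have hfin : μ D ≠ ∞ := by
    rw [hμ, withDensity_apply']
    have := (hω.2.1.integrableOn_isCompact (cube_compact _ _)).mono_set (dy_sub_cube (k : ℤ) v)
    have := this.lintegral_lt_top
    exact this.ne
  have hDm : MeasurableSet D := dy_meas _ _
  have hF : MeasurableSet (D \ E) := hDm.diff hE
  have hv : volume D ≤ 2 * volume (D \ E) := by
    have h1 : volume E + volume (D \ E) = volume D := by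
      rw [add_comm, measure_sdiff_add_inter D hE |>.symm, inter_eq_right.2 hED]
    have hVt : volume D ≠ ∞ := dy_vol_ne_top _ _
    have h2 : volume D + volume D ≤ volume D + 2 * volume (D \ E) := by
      calc volume D + volume D = 2 * volume E + 2 * volume (D \ E) := by rw [← h1]; ring
        _ ≤ _ := by gcongr
    exact (ENNReal.add_le_add_iff_left hVt).1 h2
  have h := hK k v _ hF sdiff_subset hv
  rw [← withDensity_apply' , ← withDensity_apply', ← hμ, ← hD] at h
  have h1 : μ E + μ (D \ E) = μ D := by
    rw [add_comm, measure_sdiff_add_inter D hE |>.symm, inter_eq_right.2 hED]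
  have hE' : μ E ≠ ∞ := measure_ne_top_of_subset hED hfin
  have hF' : μ (D \ E) ≠ ∞ := measure_ne_top_of_subset sdiff_subset hfin
  rw [← ENNReal.ofReal_toReal hE', ← ENNReal.ofReal_toReal hfin,
    ← ENNReal.ofReal_mul (by rw [sub_nonneg]; exact inv_le_one_of_one_le₀ hK1)]
  apply ENNReal.ofReal_le_ofReal
  have r1 : (μ E).toReal + (μ (D \ E)).toReal = (μ D).toReal := by
    rw [← h1, ENNReal.toReal_add hE' hF']
  have r2 : (μ D).toReal ≤ K * (μ (D \ E)).toReal := by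
    have := ENNReal.toReal_mono (ENNReal.mul_ne_top ENNReal.ofReal_ne_top hF') h
    rwa [ENNReal.toReal_mul, ENNReal.toReal_ofReal hK0.le] at this
  have r3 : K⁻¹ * (μ D).toReal ≤ (μ (D \ E)).toReal := by
    rw [inv_mul_le_iff₀ hK0]; exact r2
  linarith

/-! ### The good-lambda step -/

/-- Plain average of `|g|` over a dyadic cube. -/
def dA {n : ℕ} (g : En n → ℝ) (k : ℤ) (v : Fin n → ℤ) : ℝ≥0∞ :=
  (volume (dyadicCube n k v))⁻¹ * ∫⁻ y in dyadicCube n k v, ENNReal.ofReal |g y|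

/-- Dyadic subcubes of `Q` on which the average of `|g|` exceeds `t`. -/
def dS {n : ℕ} (g : En n → ℝ) (Q : Set (En n)) (t : ℝ) : Set (ℕ × (Fin n → ℤ)) :=
  {q | dyadicCube n q.1 q.2 ⊆ Q ∧ ENNReal.ofReal t < dA g q.1 q.2}

/-- The level set of the local dyadic maximal function. -/
def dU {n : ℕ} (g : En n → ℝ) (Q : Set (En n)) (t : ℝ) : Set (En n) :=
  ⋃ q ∈ dS g Q t, dyadicCube n q.1 q.2

theorem dU_meas {n : ℕ} (g : En n → ℝ) (Q : Set (En n)) (t : ℝ) : MeasurableSet (dU g Q t) :=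
  MeasurableSet.biUnion (to_countable _) fun _ _ => dy_meas _ _

theorem dU_sub {n : ℕ} (g : En n → ℝ) (Q : Set (En n)) (t : ℝ) : dU g Q t ⊆ Q :=
  iUnion₂_subset fun _ hq => hq.1

theorem dA_le_iff {n : ℕ} (g : En n → ℝ) (k : ℤ) (v : Fin n → ℤ) (a : ℝ≥0∞) :
    dA g k v ≤ a ↔ ∫⁻ y in dyadicCube n k v, ENNReal.ofReal |g y| ≤
      volume (dyadicCube n k v) * a :=
  ENNReal.inv_mul_le_iff (dy_vol_ne_zero _ _) (dy_vol_ne_top _ _)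

theorem lt_dA_iff {n : ℕ} (g : En n → ℝ) (k : ℤ) (v : Fin n → ℤ) (a : ℝ≥0∞) :
    a < dA g k v ↔ volume (dyadicCube n k v) * a <
      ∫⁻ y in dyadicCube n k v, ENNReal.ofReal |g y| := by
  rw [← not_le, dA_le_iff, not_le]

theorem weak11 {n : ℕ} {g : En n → ℝ} (k : ℕ) (v : Fin n → ℤ)
    {c τ t a : ℝ} (hc0 : 0 ≤ c) (hcτ : c ≤ τ) (hτt : τ < t) (ha : 2 * a ≤ t - τ)
    (hosc : ∫⁻ y in dyadicCube n k v, ENNReal.ofReal |g y - c| ≤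
      ENNReal.ofReal a * volume (dyadicCube n k v)) :
    2 * volume (dU g (dyadicCube n k v) t) ≤ volume (dyadicCube n k v) := by
  set Q := dyadicCube n k v with hQ
  obtain ⟨J, hJS, hJd, hJU, -⟩ := dy_select (dS g Q t)
  have hJc : J.Countable := to_countable _
  have h1 : ∀ q ∈ J, ENNReal.ofReal (t - τ) * volume (dyadicCube n q.1 q.2) ≤
      ∫⁻ y in dyadicCube n q.1 q.2, ENNReal.ofReal |g y - c| := by
    intro q hq
    have hlt := (lt_dA_iff _ _ _ _).1 (hJS hq).2
    set R := dyadicCube n q.1 q.2 with hR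
    have hRt : volume R ≠ ∞ := dy_vol_ne_top _ _
    have h2 : ∫⁻ y in R, ENNReal.ofReal |g y| ≤
        (∫⁻ y in R, ENNReal.ofReal |g y - c|) + ENNReal.ofReal τ * volume R := by
      rw [← setLIntegral_const, ← lintegral_add_right _ measurable_const]
      refine lintegral_mono fun y => ?_
      rw [← ENNReal.ofReal_add (abs_nonneg _) (hc0.trans hcτ)]
      apply ENNReal.ofReal_le_ofReal
      have := abs_add_le (g y - c) c
      rw [sub_add_cancel, abs_of_nonneg hc0] at this
      linarith
    have h3 := hlt.le.trans h2
    have e : ENNReal.ofReal t = ENNReal.ofReal (t - τ) + ENNReal.ofReal τ := by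
      rw [← ENNReal.ofReal_add (by linarith) (hc0.trans hcτ)]; congr 1; ring
    rw [e, mul_comm, add_mul] at h3
    exact (ENNReal.add_le_add_iff_right (ENNReal.mul_ne_top ENNReal.ofReal_ne_top hRt)).1 h3
  have h4 : ENNReal.ofReal (t - τ) * volume (dU g Q t) ≤
      ENNReal.ofReal a * volume Q := by
    refine le_trans ?_ hosc
    refine le_trans ?_ (lintegral_mono_set (dU_sub g Q t))
    rw [dU, hJU, measure_biUnion hJc hJd fun _ _ => dy_meas _ _,
      lintegral_biUnion hJc (fun _ _ => dy_meas _ _) hJd, ← ENNReal.tsum_mul_left]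
    exact ENNReal.tsum_le_tsum fun q => h1 q.1 q.2
  have hd0 : ENNReal.ofReal (t - τ) ≠ 0 := by simpa using hτt
  have h5 : ENNReal.ofReal (t - τ) * (2 * volume (dU g Q t)) ≤
      ENNReal.ofReal (t - τ) * volume Q := by
    calc ENNReal.ofReal (t - τ) * (2 * volume (dU g Q t))
        = 2 * (ENNReal.ofReal (t - τ) * volume (dU g Q t)) := by ring
      _ ≤ 2 * (ENNReal.ofReal a * volume Q) := by gcongr
      _ = ENNReal.ofReal (2 * a) * volume Q := by
        rw [ENNReal.ofReal_mul (by norm_num), ENNReal.ofReal_ofNat]; ring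
      _ ≤ _ := by gcongr
  exact (ENNReal.mul_le_mul_iff_right hd0 ENNReal.ofReal_ne_top).1 h5

theorem sharp_ge_one {n : ℕ} {η : ℝ} {g : En n → ℝ} (v : Fin n → ℤ) {x : En n}
    (hx : x ∈ dyadicCube n 0 v) : dA g 0 v ≤ ENNReal.ofReal (2 ^ η) * sharpMax n η g x := by
  have h1 : (ENNReal.ofReal ((1 + (2 : ℝ) ^ (-(0 : ℤ))) ^ η) * volume (dyadicCube n 0 v))⁻¹ *
      ∫⁻ y in dyadicCube n 0 v, ENNReal.ofReal |g y| ≤ sharpMax n η g x := by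
    unfold sharpMax
    refine le_trans ?_ le_add_self
    exact le_iSup₂_of_le (0 : ℤ) v (le_iSup₂_of_le hx (by norm_num) le_rfl)
  have e : (1 + (2 : ℝ) ^ (-(0 : ℤ))) = 2 := by norm_num
  rw [e, ENNReal.mul_inv (Or.inl (by simp; positivity)) (Or.inl ENNReal.ofReal_ne_top),
    mul_assoc] at h1
  rwa [ENNReal.inv_mul_le_iff (by simp; positivity) ENNReal.ofReal_ne_top] at h1

theorem sharp_ge_small {n : ℕ} {η : ℝ} {g : En n → ℝ} (k : ℕ) (hk : 0 < k) (v : Fin n → ℤ)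
    {x : En n} (hx : x ∈ dyadicCube n k v) :
    (volume (dyadicCube n k v))⁻¹ * ∫⁻ y in dyadicCube n k v,
      ENNReal.ofReal |g y - cubeAvg (dyadicCube n k v) g| ≤ sharpMax n η g x := by
  unfold sharpMax
  refine le_trans ?_ le_self_add
  refine le_iSup₂_of_le (k : ℤ) v (le_iSup₂_of_le hx ?_ le_rfl)
  rw [zpow_neg, zpow_natCast]
  exact inv_lt_one_of_one_lt₀ (one_lt_pow₀ (by norm_num) hk.ne')

theorem cubeAvg_eq {n : ℕ} {g : En n → ℝ} (hg0 : ∀ x, 0 ≤ g x) (k : ℤ) (v : Fin n → ℤ)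
    (hi : IntegrableOn g (dyadicCube n k v)) :
    0 ≤ cubeAvg (dyadicCube n k v) g ∧
      ENNReal.ofReal (cubeAvg (dyadicCube n k v) g) = dA g k v := by
  have hI : 0 ≤ ∫ y in dyadicCube n k v, g y := integral_nonneg hg0
  refine ⟨mul_nonneg (by positivity) hI, ?_⟩
  unfold cubeAvg dA
  rw [ENNReal.ofReal_mul (by positivity), ofReal_integral_eq_lintegral_ofReal hi
    (Eventually.of_forall hg0), ENNReal.ofReal_inv_of_pos
      (ENNReal.toReal_pos (dy_vol_ne_zero _ _) (dy_vol_ne_top _ _)),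
    ENNReal.ofReal_toReal (dy_vol_ne_top _ _)]
  simp only [abs_of_nonneg (hg0 _)]

/-- Oscillation bound on small dyadic cubes at a point where the sharp function is small. -/
theorem osc_bound {n : ℕ} {η : ℝ} (hη : 0 < η) {g : En n → ℝ} (hg0 : ∀ x, 0 ≤ g x)
    (k : ℕ) (v : Fin n → ℤ)
    {x : En n} (hx : x ∈ dyadicCube n k v) {s : ℝ} (hs : 0 < s)
    (hsx : sharpMax n η g x ≤ ENNReal.ofReal s)
    (hi : IntegrableOn g (dyadicCube n k v)) :
    ∫⁻ y in dyadicCube n k v, ENNReal.ofReal |g y - cubeAvg (dyadicCube n k v) g| ≤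
      ENNReal.ofReal (2 * 2 ^ η * s) * volume (dyadicCube n k v) := by
  have h2η : (1 : ℝ) ≤ 2 ^ η := Real.one_le_rpow (by norm_num) hη.le
  rcases Nat.eq_zero_or_pos k with rfl | hk
  · have h1 := sharp_ge_one (η := η) (g := g) v (by simpa using hx)
    have hca := cubeAvg_eq hg0 _ v hi
    have h3 : dA g 0 v ≤ ENNReal.ofReal (2 ^ η * s) := by
      rw [ENNReal.ofReal_mul (by positivity)]
      exact h1.trans (by gcongr)
    simp only [Nat.cast_zero] at *
    set c := cubeAvg (dyadicCube n 0 v) g with hc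
    calc ∫⁻ y in dyadicCube n 0 v, ENNReal.ofReal |g y - c|
        ≤ ∫⁻ y in dyadicCube n 0 v, (ENNReal.ofReal |g y| + ENNReal.ofReal c) := by
          refine lintegral_mono fun y => ?_
          rw [← ENNReal.ofReal_add (abs_nonneg _) hca.1]
          apply ENNReal.ofReal_le_ofReal
          have := abs_sub (g y) c
          rwa [abs_of_nonneg hca.1] at this
      _ = (∫⁻ y in dyadicCube n 0 v, ENNReal.ofReal |g y|) +
          ENNReal.ofReal c * volume (dyadicCube n 0 v) := by
          rw [lintegral_add_right _ measurable_const, setLIntegral_const]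
      _ ≤ volume (dyadicCube n 0 v) * ENNReal.ofReal (2 ^ η * s) +
          ENNReal.ofReal (2 ^ η * s) * volume (dyadicCube n 0 v) := by
          rw [hca.2]
          gcongr
          exact (dA_le_iff _ _ _ _).1 h3
      _ = _ := by
          rw [mul_assoc 2, ENNReal.ofReal_mul (p := 2) (by norm_num), ENNReal.ofReal_ofNat]
          ring
  · have h1 := (sharp_ge_small (η := η) (g := g) k hk v hx).trans hsx
    rw [ENNReal.inv_mul_le_iff (dy_vol_ne_zero _ _) (dy_vol_ne_top _ _), mul_comm] at h1
    refine h1.trans ?_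
    gcongr
    nlinarith

theorem good_step {n : ℕ} {η : ℝ} (hη : 0 < η) {g : En n → ℝ} (hg : Measurable g)
    (hg0 : ∀ x, 0 ≤ g x) (μ : Measure (En n)) {ε : ℝ}
    (hε : ∀ (k : ℕ) (v : Fin n → ℤ) (E : Set (En n)), MeasurableSet E →
      E ⊆ dyadicCube n k v → 2 * volume E ≤ volume (dyadicCube n k v) →
      μ E ≤ ENNReal.ofReal ε * μ (dyadicCube n k v))
    (v₀ : Fin n → ℤ) {s τ t : ℝ} (hs : 0 < s) (hτt : τ < t)
    (hsτ : 2 ^ η * s ≤ τ) (hst : 2 * (2 * 2 ^ η * s * 2 ^ n) ≤ t - τ) :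
    μ (dU g (dyadicCube n 0 v₀) t) ≤
      μ (dyadicCube n 0 v₀ ∩ {x | ENNReal.ofReal s < sharpMax n η g x}) +
      ENNReal.ofReal ε * μ (dU g (dyadicCube n 0 v₀) τ) := by
  have hτ0 : 0 < τ := lt_of_lt_of_le (by positivity) hsτ
  set P := dyadicCube n 0 v₀ with hP
  set Z := {x | ENNReal.ofReal s < sharpMax n η g x} with hZ
  by_cases hA : dA g 0 v₀ ≤ ENNReal.ofReal (2 ^ η * s)
  swap
  · have hPZ : P ⊆ Z := by
      intro x hx
      rw [not_le, ENNReal.ofReal_mul (by positivity)] at hA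
      exact (ENNReal.mul_lt_mul_iff_right (by simp; positivity) ENNReal.ofReal_ne_top).1
        (hA.trans_le (sharp_ge_one v₀ hx))
    refine le_trans (measure_mono ?_) le_self_add
    exact (dU_sub g P t).trans (subset_inter subset_rfl hPZ)
  have hint : IntegrableOn g P := by
    refine ⟨hg.aestronglyMeasurable, ?_⟩
    rw [dA_le_iff] at hA
    have : (∫⁻ y in P, ENNReal.ofReal |g y|) < ∞ :=
      hA.trans_lt (ENNReal.mul_lt_top (dy_vol_ne_top _ _).lt_top ENNReal.ofReal_lt_top)
    rw [HasFiniteIntegral]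
    simpa only [← ofReal_norm, Real.norm_eq_abs] using this
  obtain ⟨J, hJS, hJd, hJU, hJm⟩ := dy_select (dS g P τ)
  have hJc : J.Countable := to_countable _
  have hUU : dU g P t ⊆ dU g P τ := by
    refine biUnion_mono (fun q hq => ⟨hq.1, lt_of_le_of_lt ?_ hq.2⟩) fun _ _ => subset_rfl
    exact ENNReal.ofReal_le_ofReal hτt.le
  -- the claim on each maximal cube
  have claim : ∀ q ∈ J, μ (dU g P t ∩ dyadicCube n q.1 q.2) ≤
      μ.restrict Z (dyadicCube n q.1 q.2) + ENNReal.ofReal ε * μ (dyadicCube n q.1 q.2) := by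
    rintro ⟨k, v⟩ hq
    simp only
    by_cases hZQ : dyadicCube n k v ⊆ Z
    · refine le_trans ?_ le_self_add
      rw [Measure.restrict_apply (dy_meas _ _), inter_eq_left.2 hZQ]
      exact measure_mono inter_subset_right
    refine le_trans ?_ le_add_self
    obtain ⟨x, hx, hxZ⟩ := not_subset.1 hZQ
    have hsx : sharpMax n η g x ≤ ENNReal.ofReal s := not_lt.1 hxZ
    have hQP : dyadicCube n k v ⊆ P := (hJS hq).1
    have hQA : ENNReal.ofReal τ < dA g k v := (hJS hq).2
    -- `k` is positive
    obtain ⟨k, rfl⟩ : ∃ j, k = j + 1 := by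
      refine Nat.exists_eq_succ_of_ne_zero ?_
      rintro rfl
      have : v = v₀ := dy_eq (k := 0) (by simpa using hx) (hQP hx)
      subst this
      exact absurd (hA.trans (ENNReal.ofReal_le_ofReal hsτ)) (not_le.2 (by simpa using hQA))
    obtain ⟨w, hw⟩ := dy_exists (k : ℤ) x
    have hQw : dyadicCube n ((k + 1 : ℕ) : ℤ) v ⊆ dyadicCube n k w :=
      dy_nest (by push_cast; linarith) hw hx
    have hwP : dyadicCube n k w ⊆ P := dy_nest (by positivity) (hQP hx) hw
    have hwA : dA g k w ≤ ENNReal.ofReal τ := by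
      by_contra hcon
      exact hJm _ hq (k, w) ⟨hwP, not_le.1 hcon⟩ (Nat.lt_succ_self k) hQw
    have hiw := hint.mono_set hwP
    obtain ⟨hc0, hce⟩ := cubeAvg_eq hg0 _ w hiw
    have hosc := osc_bound hη hg0 k w hw hs hsx hiw
    set c := cubeAvg (dyadicCube n k w) g with hc
    have hcτ : c ≤ τ := by
      rw [← hce] at hwA
      exact (ENNReal.ofReal_le_ofReal_iff hτ0.le).1 hwA
    have hosc2 : ∫⁻ y in dyadicCube n ((k + 1 : ℕ) : ℤ) v, ENNReal.ofReal |g y - c| ≤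
        ENNReal.ofReal (2 * 2 ^ η * s * 2 ^ n) * volume (dyadicCube n ((k + 1 : ℕ) : ℤ) v) := by
      refine (lintegral_mono_set hQw).trans (hosc.trans (le_of_eq ?_))
      rw [dy_vol_parent (k : ℤ) w v, ENNReal.ofReal_mul (q := 2 ^ n) (by positivity),
        ENNReal.ofReal_pow (by norm_num), ENNReal.ofReal_ofNat]
      push_cast
      ring
    have hvol := weak11 (k + 1) v hc0 hcτ hτt hst hosc2
    have hsub : dU g P t ∩ dyadicCube n ((k + 1 : ℕ) : ℤ) v ⊆
        dU g (dyadicCube n ((k + 1 : ℕ) : ℤ) v) t := by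
      rintro y ⟨hy, hyQ⟩
      simp only [dU, mem_iUnion] at hy ⊢
      obtain ⟨q, hqS, hyq⟩ := hy
      refine ⟨q, ⟨?_, hqS.2⟩, hyq⟩
      rcases le_or_gt (k + 1) q.1 with h | h
      · exact dy_nest (by exact_mod_cast h) hyQ hyq
      · exact absurd (dy_nest (by exact_mod_cast h.le) hyq hyQ)
          (hJm _ hq q ⟨hqS.1, lt_of_le_of_lt (ENNReal.ofReal_le_ofReal hτt.le) hqS.2⟩ h)
    exact (measure_mono hsub).trans (hε (k + 1) v _ (dU_meas _ _ _) (dU_sub _ _ _) hvol)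
  have hcov : dU g P t = ⋃ q ∈ J, (dU g P t ∩ dyadicCube n q.1 q.2) := by
    rw [← inter_iUnion₂, ← hJU]
    exact (inter_eq_left.2 hUU).symm
  calc μ (dU g P t) ≤ ∑' q : J, μ (dU g P t ∩ dyadicCube n q.1.1 q.1.2) := by
        conv_lhs => rw [hcov]
        exact measure_biUnion_le _ hJc _
    _ ≤ ∑' q : J, (μ.restrict Z (dyadicCube n q.1.1 q.1.2) +
          ENNReal.ofReal ε * μ (dyadicCube n q.1.1 q.1.2)) :=
        ENNReal.tsum_le_tsum fun q => claim q.1 q.2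
    _ = μ.restrict Z (dU g P τ) + ENNReal.ofReal ε * μ (dU g P τ) := by
        rw [ENNReal.tsum_add, ENNReal.tsum_mul_left, dU, hJU,
          measure_biUnion hJc hJd fun _ _ => dy_meas _ _,
          measure_biUnion hJc hJd fun _ _ => dy_meas _ _]
    _ ≤ _ := by
        refine add_le_add ?_ le_rfl
        rw [Measure.restrict_apply (dU_meas _ _ _)]
        exact measure_mono (inter_subset_inter_left _ (dU_sub _ _ _))

/-! ### Iteration -/

theorem good_block {n : ℕ} {η : ℝ} (hη : 0 < η) {g : En n → ℝ} (hg : Measurable g)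
    (hg0 : ∀ x, 0 ≤ g x) (μ : Measure (En n)) {ε : ℝ} (hε1 : ε ≤ 1)
    (hε : ∀ (k : ℕ) (v : Fin n → ℤ) (E : Set (En n)), MeasurableSet E →
      E ⊆ dyadicCube n k v → 2 * volume E ≤ volume (dyadicCube n k v) →
      μ E ≤ ENNReal.ofReal ε * μ (dyadicCube n k v))
    (v₀ : Fin n → ℤ) {N : ℕ} (hN : 0 < N) {a s t : ℝ} (ha1 : a < 1)
    (ht : 0 < t) (hs : 0 < s)
    (hsτ : 2 ^ η * s ≤ a * t) (hst : 2 * (2 * 2 ^ η * s * 2 ^ n) ≤ t * (1 - a) / N) :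
    μ (dU g (dyadicCube n 0 v₀) t) ≤
      N * μ (dyadicCube n 0 v₀ ∩ {x | ENNReal.ofReal s < sharpMax n η g x}) +
      ENNReal.ofReal ε ^ N * μ (dU g (dyadicCube n 0 v₀) (a * t)) := by
  set z := μ (dyadicCube n 0 v₀ ∩ {x | ENNReal.ofReal s < sharpMax n η g x}) with hz
  set d := t * (1 - a) / N with hd
  have hN' : (0 : ℝ) < N := by exact_mod_cast hN
  have hd0 : 0 < d := div_pos (mul_pos ht (by linarith)) hN'
  have hNd : N * d = t * (1 - a) := by rw [hd]; field_simp
  have hεe : ENNReal.ofReal ε ≤ 1 := by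
    rw [← ENNReal.ofReal_one]; exact ENNReal.ofReal_le_ofReal hε1
  have key : ∀ j : ℕ, j ≤ N → μ (dU g (dyadicCube n 0 v₀) t) ≤
      j * z + ENNReal.ofReal ε ^ j * μ (dU g (dyadicCube n 0 v₀) (t - j * d)) := by
    intro j
    induction j with
    | zero => intro _; simp
    | succ j ih =>
      intro hj
      have hj' : ((j + 1 : ℕ) : ℝ) ≤ N := by exact_mod_cast hj
      have h1 := ih (by omega)
      have h2 := good_step hη hg hg0 μ hε v₀ (s := s) (τ := t - (j + 1 : ℕ) * d)
        (t := t - j * d) hs (by push_cast; linarith) (by nlinarith) (by push_cast; linarith)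
      refine h1.trans ?_
      calc j * z + ENNReal.ofReal ε ^ j * μ (dU g (dyadicCube n 0 v₀) (t - j * d))
          ≤ j * z + ENNReal.ofReal ε ^ j * (z + ENNReal.ofReal ε *
            μ (dU g (dyadicCube n 0 v₀) (t - (j + 1 : ℕ) * d))) := by gcongr
        _ = j * z + ENNReal.ofReal ε ^ j * z + ENNReal.ofReal ε ^ (j + 1) *
            μ (dU g (dyadicCube n 0 v₀) (t - (j + 1 : ℕ) * d)) := by ring
        _ ≤ j * z + 1 * z + ENNReal.ofReal ε ^ (j + 1) *
            μ (dU g (dyadicCube n 0 v₀) (t - (j + 1 : ℕ) * d)) := by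
              gcongr; exact pow_le_one₀ bot_le hεe
        _ = _ := by push_cast; ring
  have h := key N le_rfl
  have e : t - N * d = a * t := by rw [hNd]; ring
  rwa [e] at h

/-- Infinite iteration of `u i ≤ b i + e * u (i+1)` for bounded `u`. -/
theorem iterate_bound (u b : ℕ → ℝ≥0∞) (e M : ℝ≥0∞) (he : e < 1) (hM : M ≠ ∞)
    (hu : ∀ i, u i ≤ M) (h : ∀ i, u i ≤ b i + e * u (i + 1)) :
    u 0 ≤ ∑' i, e ^ i * b i := by
  have key : ∀ K : ℕ, u 0 ≤ (∑' i, e ^ i * b i) + e ^ K * M := by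
    intro K
    have : u 0 ≤ (∑ i ∈ Finset.range K, e ^ i * b i) + e ^ K * u K := by
      induction K with
      | zero => simp
      | succ K ih =>
        refine ih.trans ?_
        rw [Finset.sum_range_succ, add_assoc]
        gcongr
        calc e ^ K * u K ≤ e ^ K * (b K + e * u (K + 1)) := by gcongr; exact h K
          _ = _ := by ring
    refine this.trans ?_
    gcongr
    · exact ENNReal.sum_le_tsum _
    · exact hu K
  have hlim : Tendsto (fun K : ℕ => (∑' i, e ^ i * b i) + e ^ K * M) atTop
      (nhds ((∑' i, e ^ i * b i) + 0 * M)) := by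
    refine Tendsto.add tendsto_const_nhds ?_
    exact ENNReal.Tendsto.mul_const (ENNReal.tendsto_pow_atTop_nhds_zero_of_lt_one he)
      (Or.inr hM)
  have := ge_of_tendsto' hlim key
  simpa using this

theorem max_sub {n : ℕ} {η : ℝ} (hη : 0 < η) (g : En n → ℝ) (v₀ : Fin n → ℤ) (T : ℝ)
    {x : En n} (hx : x ∈ dyadicCube n 0 v₀) (h : ENNReal.ofReal T < dyadicMax n η g x) :
    x ∈ dU g (dyadicCube n 0 v₀) T ∨ ENNReal.ofReal T < sharpMax n η g x := by
  unfold dyadicMax at h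
  simp only [lt_iSup_iff] at h
  obtain ⟨k, v, hxv, hlt⟩ := h
  rcases le_or_gt k 0 with hk | hk
  · right
    refine hlt.trans_le ?_
    unfold sharpMax
    refine le_trans ?_ le_add_self
    refine le_iSup₂_of_le k v (le_iSup₂_of_le hxv ?_ le_rfl)
    exact one_le_zpow₀ (by norm_num) (by linarith)
  · left
    lift k to ℕ using hk.le
    simp only [dU, mem_iUnion]
    refine ⟨(k, v), ⟨dy_nest hk.le hx hxv, hlt.trans_le ?_⟩, hxv⟩
    unfold dA
    refine mul_le_mul_left (ENNReal.inv_le_inv.2 ?_) _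
    refine le_mul_of_one_le_left bot_le ?_
    rw [← ENNReal.ofReal_one]
    apply ENNReal.ofReal_le_ofReal
    refine Real.one_le_rpow ?_ hη.le
    have : (0 : ℝ) < 2 ^ (-(k : ℤ)) := by positivity
    linarith

theorem lt_rpow_inv {lam δ : ℝ} (hl : 0 < lam) (hδ : 0 < δ) (X : ℝ≥0∞) :
    ENNReal.ofReal lam < X ^ (1 / δ) ↔ ENNReal.ofReal (lam ^ δ) < X := by
  rw [one_div, ENNReal.lt_rpow_inv_iff hδ, ENNReal.ofReal_rpow_of_nonneg hl.le hδ.le]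

theorem unit_sum {n : ℕ} (μ : Measure (En n)) (S : Set (En n)) :
    ∑' v : Fin n → ℤ, μ (dyadicCube n 0 v ∩ S) = μ S := by
  have h1 : ∀ v : Fin n → ℤ, μ (dyadicCube n 0 v ∩ S) = μ.restrict S (dyadicCube n 0 v) :=
    fun v => (Measure.restrict_apply (dy_meas _ _)).symm
  simp only [h1]
  rw [← measure_iUnion ?_ fun v => dy_meas _ _]
  · have : (⋃ v : Fin n → ℤ, dyadicCube n 0 v) = univ := by
      ext x
      simpa using dy_exists 0 x
    rw [this, Measure.restrict_apply_univ]
  · intro v v' hne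
    rw [Function.onFun, Set.disjoint_left]
    exact fun x hx hx' => hne (dy_eq hx hx')

/-- Lemma 2.5: the good-λ type inequality between the dyadic maximal function
`M^△_{δ,φ,η}` and the dyadic sharp maximal function `M^{♯,△}_{δ,φ,η}` for
`ω ∈ A_∞^∞(φ)` and doubling `ψ`. -/
theorem stmt14 (n : ℕ) (hn : 0 < n) (η δ : ℝ) (hη : 0 < η) (hδ : 0 < δ)
    (ω : En n → ℝ) (hω : ∃ p ≥ 1, ∃ θ ≥ 0, ApTheta n p θ ω)
    (ψ : ℝ → ℝ) (hψ : ∀ a > 0, 0 < ψ a)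
    (C₀ : ℝ) (hC₀ : ∀ a > 0, ψ (2 * a) ≤ C₀ * ψ a) :
    ∃ C > 0, ∀ f : En n → ℝ, Measurable f →
      (⨆ (lam : ℝ) (_ : 0 < lam), ENNReal.ofReal (ψ lam) *
          ∫⁻ y in {y | ENNReal.ofReal lam < dyadicMaxDelta n δ η f y},
            ENNReal.ofReal (ω y)) ≤
        ENNReal.ofReal C *
          ⨆ (lam : ℝ) (_ : 0 < lam), ENNReal.ofReal (ψ lam) *
            ∫⁻ y in {y | ENNReal.ofReal lam < sharpMaxDelta n δ η f y},
              ENNReal.ofReal (ω y) := by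
  obtain ⟨p, hp, θ, hθ, hA⟩ := hω
  obtain ⟨ε, hε0, hε1, hε⟩ := weight_small hp hθ hA
  set μ := volume.withDensity (fun y => ENNReal.ofReal (ω y)) with hμ
  -- constants
  set C₁ : ℝ := max C₀ 1 with hC₁
  have hC₁1 : 1 ≤ C₁ := le_max_right _ _
  have hC₁0 : 0 < C₁ := by linarith
  have hdoub : ∀ (j : ℕ) (a : ℝ), 0 < a → ψ a ≤ C₁ ^ j * ψ (a / 2 ^ j) := by
    intro j
    induction j with
    | zero => intro a ha; simp
    | succ j ih =>
      intro a ha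
      have ha' : 0 < a / 2 ^ (j + 1) := by positivity
      have h1 := hC₀ _ ha'
      have e : 2 * (a / 2 ^ (j + 1)) = a / 2 ^ j := by rw [pow_succ]; field_simp
      rw [e] at h1
      have h2 : C₀ * ψ (a / 2 ^ (j + 1)) ≤ C₁ * ψ (a / 2 ^ (j + 1)) :=
        mul_le_mul_of_nonneg_right (le_max_left _ _) (hψ _ ha').le
      calc ψ a ≤ C₁ ^ j * ψ (a / 2 ^ j) := ih a ha
        _ ≤ C₁ ^ j * (C₁ * ψ (a / 2 ^ (j + 1))) := by gcongr; linarith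
        _ = _ := by ring
  set e : ℝ := (2 * C₁)⁻¹ with he
  have he0 : 0 < e := by positivity
  have he1 : e < 1 := inv_lt_one_of_one_lt₀ (by linarith)
  obtain ⟨N₀, hN₀⟩ := exists_pow_lt_of_lt_one he0 hε1
  set N := N₀ + 1 with hN
  have hNe : ε ^ N ≤ e := (pow_le_pow_of_le_one hε0 hε1.le (Nat.le_succ N₀)).trans hN₀.le
  have hN0 : 0 < N := Nat.succ_pos _
  have hNr : (0 : ℝ) < N := by exact_mod_cast hN0
  set a : ℝ := 2 ^ (-δ) with ha
  have ha0 : 0 < a := by positivity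
  have ha1 : a < 1 := Real.rpow_lt_one_of_one_lt_of_neg (by norm_num) (by linarith)
  have h2η : (0 : ℝ) < 2 ^ η := by positivity
  obtain ⟨m, hm⟩ : ∃ m : ℕ, a ^ m < min (a / 2 ^ η) ((1 - a) / N / (2 * (2 * 2 ^ η * 2 ^ n))) := by
    refine exists_pow_lt_of_lt_one (lt_min (by positivity) ?_) ha1
    have : 0 < 1 - a := by linarith
    positivity
  have hm1 : 2 ^ η * a ^ m ≤ a := by
    have := (hm.trans_le (min_le_left _ _)).le
    rwa [le_div_iff₀ h2η, mul_comm] at this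
  have hm2 : 2 * (2 * 2 ^ η * 2 ^ n) * a ^ m ≤ (1 - a) / N := by
    have := (hm.trans_le (min_le_right _ _)).le
    rwa [le_div_iff₀ (by positivity), mul_comm] at this
  have hscale : ∀ (j : ℕ) (lam : ℝ), 0 < lam → (lam / 2 ^ j) ^ δ = a ^ j * lam ^ δ := by
    intro j lam hl
    rw [Real.div_rpow hl.le (by positivity), div_eq_mul_inv, mul_comm, ha,
      ← Real.rpow_natCast (2 ^ (-δ)), ← Real.rpow_mul (by norm_num),
      ← Real.rpow_natCast (2 : ℝ), ← Real.rpow_mul (by norm_num), ← Real.rpow_neg (by norm_num)]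
    congr 2
    ring
  refine ⟨1 + N * C₁ ^ m * 2, by positivity, ?_⟩
  intro f hf
  set g : En n → ℝ := fun y => |f y| ^ δ with hg
  have hgm : Measurable g := by
    have : Measurable fun y => |f y| := by fun_prop
    exact this.pow_const δ
  have hg0 : ∀ x, 0 ≤ g x := fun x => by positivity
  set Z : ℝ → Set (En n) := fun s => {x | ENNReal.ofReal s < sharpMax n η g x} with hZ
  set R := ⨆ (lam : ℝ) (_ : 0 < lam), ENNReal.ofReal (ψ lam) *
            ∫⁻ y in {y | ENNReal.ofReal lam < sharpMaxDelta n δ η f y},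
              ENNReal.ofReal (ω y) with hR
  have hRle : ∀ lam : ℝ, 0 < lam → ENNReal.ofReal (ψ lam) * μ (Z (lam ^ δ)) ≤ R := by
    intro lam hl
    have e1 : {y | ENNReal.ofReal lam < sharpMaxDelta n δ η f y} = Z (lam ^ δ) := by
      ext y
      exact lt_rpow_inv hl hδ _
    rw [hR]
    refine le_iSup₂_of_le lam hl ?_
    rw [e1, hμ, withDensity_apply']
  -- the distributional inequality
  have hloc : ∀ (v : Fin n → ℤ) (t : ℝ), 0 < t → μ (dU g (dyadicCube n 0 v) t) ≤
      ∑' i : ℕ, ENNReal.ofReal e ^ i * (N * μ (dyadicCube n 0 v ∩ Z (a ^ (m + i) * t))) := by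
    intro v t ht
    have hfin : μ (dyadicCube n 0 v) ≠ ∞ := by
      rw [hμ, withDensity_apply']
      have := (hA.2.1.integrableOn_isCompact (cube_compact _ _)).mono_set (dy_sub_cube 0 v)
      exact this.lintegral_lt_top.ne
    have := iterate_bound (fun i => μ (dU g (dyadicCube n 0 v) (a ^ i * t)))
      (fun i => N * μ (dyadicCube n 0 v ∩ Z (a ^ (m + i) * t))) (ENNReal.ofReal e)
      (μ (dyadicCube n 0 v))
      (by rw [← ENNReal.ofReal_one]; exact (ENNReal.ofReal_lt_ofReal_iff one_pos).2 he1)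
      hfin (fun i => measure_mono (dU_sub _ _ _)) ?_
    · simpa using this
    · intro i
      have hti : 0 < a ^ i * t := by positivity
      have h1 := good_block hη hgm hg0 μ hε1.le hε v hN0 (a := a) (s := a ^ (m + i) * t)
        (t := a ^ i * t) ha1 hti (by positivity)
        (by
          calc 2 ^ η * (a ^ (m + i) * t) = (2 ^ η * a ^ m) * (a ^ i * t) := by rw [pow_add]; ring
            _ ≤ a * (a ^ i * t) := by gcongr)
        (by
          calc 2 * (2 * 2 ^ η * (a ^ (m + i) * t) * 2 ^ n)
              = (2 * (2 * 2 ^ η * 2 ^ n) * a ^ m) * (a ^ i * t) := by rw [pow_add]; ring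
            _ ≤ ((1 - a) / N) * (a ^ i * t) := by gcongr
            _ = _ := by ring)
      refine h1.trans ?_
      have e2 : a * (a ^ i * t) = a ^ (i + 1) * t := by ring
      rw [e2, ← ENNReal.ofReal_pow hε0]
      gcongr
  have hdist : ∀ t : ℝ, 0 < t → μ {x | ENNReal.ofReal t < dyadicMax n η g x} ≤
      μ (Z t) + ∑' i : ℕ, ENNReal.ofReal e ^ i * (N * μ (Z (a ^ (m + i) * t))) := by
    intro t ht
    rw [← unit_sum μ {x | ENNReal.ofReal t < dyadicMax n η g x}]
    calc ∑' v : Fin n → ℤ, μ (dyadicCube n 0 v ∩ {x | ENNReal.ofReal t < dyadicMax n η g x})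
        ≤ ∑' v : Fin n → ℤ, (μ (dyadicCube n 0 v ∩ Z t) +
          ∑' i : ℕ, ENNReal.ofReal e ^ i * (N * μ (dyadicCube n 0 v ∩ Z (a ^ (m + i) * t)))) := by
          refine ENNReal.tsum_le_tsum fun v => ?_
          refine le_trans ?_ (add_le_add le_rfl (hloc v t ht))
          refine le_trans (measure_mono ?_) (measure_union_le _ _)
          rintro x ⟨hx, hxt⟩
          rcases max_sub hη g v t hx hxt with h | h
          · exact Or.inr h
          · exact Or.inl ⟨hx, h⟩
      _ = _ := by
          rw [ENNReal.tsum_add, unit_sum, ENNReal.tsum_comm]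
          simp only [ENNReal.tsum_mul_left, unit_sum]
  refine iSup₂_le fun lam hl => ?_
  have e1 : {y | ENNReal.ofReal lam < dyadicMaxDelta n δ η f y} =
      {x | ENNReal.ofReal (lam ^ δ) < dyadicMax n η g x} := by
    ext y
    exact lt_rpow_inv hl hδ _
  rw [e1, ← withDensity_apply', ← hμ]
  have hterm : ∀ i : ℕ, ENNReal.ofReal (ψ lam) * (ENNReal.ofReal e ^ i *
      (N * μ (Z (a ^ (m + i) * lam ^ δ)))) ≤ ENNReal.ofReal (N * C₁ ^ m * (1 / 2) ^ i) * R := by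
    intro i
    have hl' : 0 < lam / 2 ^ (m + i) := by positivity
    have h1 := hRle _ hl'
    rw [hscale _ _ hl] at h1
    have h2 : ENNReal.ofReal (ψ lam) ≤
        ENNReal.ofReal (C₁ ^ (m + i)) * ENNReal.ofReal (ψ (lam / 2 ^ (m + i))) := by
      rw [← ENNReal.ofReal_mul (by positivity)]
      exact ENNReal.ofReal_le_ofReal (hdoub _ _ hl)
    calc ENNReal.ofReal (ψ lam) * (ENNReal.ofReal e ^ i * (N * μ (Z (a ^ (m + i) * lam ^ δ))))
        ≤ ENNReal.ofReal (C₁ ^ (m + i)) * ENNReal.ofReal (ψ (lam / 2 ^ (m + i))) *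
          (ENNReal.ofReal e ^ i * (N * μ (Z (a ^ (m + i) * lam ^ δ)))) := by gcongr
      _ = (ENNReal.ofReal (C₁ ^ (m + i)) * ENNReal.ofReal e ^ i * N) *
          (ENNReal.ofReal (ψ (lam / 2 ^ (m + i))) * μ (Z (a ^ (m + i) * lam ^ δ))) := by ring
      _ ≤ (ENNReal.ofReal (C₁ ^ (m + i)) * ENNReal.ofReal e ^ i * N) * R := by gcongr
      _ = _ := by
        congr 1
        rw [← ENNReal.ofReal_natCast, ← ENNReal.ofReal_pow he0.le,
          ← ENNReal.ofReal_mul (by positivity), ← ENNReal.ofReal_mul (by positivity)]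
        congr 1
        rw [he, pow_add, inv_pow, mul_pow, one_div, inv_pow]
        field_simp
  calc ENNReal.ofReal (ψ lam) * μ {x | ENNReal.ofReal (lam ^ δ) < dyadicMax n η g x}
      ≤ ENNReal.ofReal (ψ lam) * (μ (Z (lam ^ δ)) + ∑' i : ℕ, ENNReal.ofReal e ^ i *
          (N * μ (Z (a ^ (m + i) * lam ^ δ)))) := by
        gcongr
        exact hdist _ (by positivity)
    _ = ENNReal.ofReal (ψ lam) * μ (Z (lam ^ δ)) + ∑' i : ℕ, ENNReal.ofReal (ψ lam) *
          (ENNReal.ofReal e ^ i * (N * μ (Z (a ^ (m + i) * lam ^ δ)))) := by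
        rw [mul_add, ENNReal.tsum_mul_left]
    _ ≤ R + ∑' i : ℕ, ENNReal.ofReal (N * C₁ ^ m * (1 / 2) ^ i) * R :=
        add_le_add (hRle lam hl) (ENNReal.tsum_le_tsum hterm)
    _ = ENNReal.ofReal (1 + N * C₁ ^ m * 2) * R := by
        rw [ENNReal.tsum_mul_right, ← ENNReal.ofReal_tsum_of_nonneg (fun i => by positivity)
          (summable_geometric_two.mul_left _), tsum_mul_left, tsum_geometric_two,
          ENNReal.ofReal_add (by norm_num) (by positivity), ENNReal.ofReal_one, add_mul, one_mul]

end
end
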